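/- Theorem (Graczyk's estimates). Let f be a degree-one endomorphism of 𝕋¹ satisfying conditions (A1) and (A2), with critical point c⁺ of non-flatness order ℓ⁺ and upper rotation number ρ⁺ with continued-fraction partial quotients (a_k⁺) and denominators (q_k⁺). Then there exists C > 0 such that for every n ≥ 1: C⁻¹ · Π_{0<k≤n} (1 + a⁺_{2k+1}/ℓ⁺) ≤ |log d(f^{q⁺_{2n+1}}(c⁺), c⁺)| ≤ C · Π_{0<k≤n} (1 + ((ℓ⁺+1)/(ℓ⁺−1)) · a⁺_{2k+1}). -/

import Mathlib

open MeasureTheory Set Filter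

noncomputable section

/-- Iterated fractional parts in the continued fraction algorithm:
`cfFrac ρ 0 = ρ - ⌊ρ⌋` and `cfFrac ρ (k+1) = 1/(cfFrac ρ k) - ⌊1/(cfFrac ρ k)⌋`. -/
noncomputable def cfFrac (ρ : ℝ) : ℕ → ℝ
  | 0 => Int.fract ρ
  | n + 1 => Int.fract (1 / cfFrac ρ n)

/-- Partial quotients `a_k` of the continued fraction expansion of `ρ`. -/
noncomputable def cfA (ρ : ℝ) : ℕ → ℤ
  | 0 => ⌊ρ⌋
  | n + 1 => ⌊1 / cfFrac ρ n⌋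

/-- Denominators `q_k` of the convergents of `ρ`:
`q_0 = 1`, `q_1 = a_1` (since `q_{-1} = 0`), `q_{k+1} = a_{k+1} q_k + q_{k-1}`. -/
noncomputable def cfQ (ρ : ℝ) : ℕ → ℕ
  | 0 => 1
  | 1 => (cfA ρ 1).toNat
  | n + 2 => (cfA ρ (n + 2)).toNat * cfQ ρ (n + 1) + cfQ ρ n
/-- The class `Bimod` of degree one bimodal circle endomorphisms, given by the
circle map `f : 𝕋¹ → 𝕋¹` together with a lift `F : ℝ → ℝ` (`π ∘ F = f ∘ π`,
`F(x+1) = F(x)+1`), satisfying (A1) (`C²`, bimodal with non-flat critical points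
`c̃⁺ < c̃⁻` of orders `ℓ⁺, ℓ⁻`), (A2) (the rotation numbers of the upper and lower
maps `F₊, F₋` are irrational) and (A3) (all periodic orbits are hyperbolic repelling). -/
structure BimodA12Data where
  /-- the lift -/
  F : ℝ → ℝ
  /-- the circle endomorphism -/
  f : UnitAddCircle → UnitAddCircle
  /-- lift of the critical point `c⁺` -/
  ctp : ℝ
  /-- lift of the critical point `c⁻` -/
  ctm : ℝ
  /-- `d̃⁺`, the second preimage of the critical value of `c⁺` -/
  dtp : ℝ
  /-- `d̃⁻`, the second preimage of the critical value of `c⁻` -/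
  dtm : ℝ
  /-- the non-flatness order `ℓ⁺` -/
  lp : ℝ
  /-- the non-flatness order `ℓ⁻` -/
  lm : ℝ
  /-- the upper map `F₊` (a monotone degree one lift) -/
  Fp : CircleDeg1Lift
  /-- the lower map `F₋` (a monotone degree one lift) -/
  Fm : CircleDeg1Lift
  /-- the diffeomorphism `ψ⁺` -/
  psip : ℝ → ℝ
  /-- the diffeomorphism `ψ⁻` -/
  psim : ℝ → ℝ
  hf : ∀ x : ℝ, f ((x : ℝ) : UnitAddCircle) = ((F x : ℝ) : UnitAddCircle)
  h0 : 0 < ctp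
  h1 : ctp < ctm
  h2 : ctm < 1
  hlift : ∀ x, F (x + 1) = F x + 1
  hC2 : ContDiff ℝ 2 F
  hdecr : ∀ x ∈ Set.Ioo ctp ctm, deriv F x < 0
  hincr : ∀ x ∈ Set.Ioo ctm (ctp + 1), 0 < deriv F x
  hlp : 1 < lp
  hlm : 1 < lm
  hpsipC2 : ContDiff ℝ 2 psip
  hpsipBij : Function.Bijective psip
  hpsipD : ∀ x, deriv psip x ≠ 0
  hpsip0 : psip ctp = 0
  hpsipEq : ∀ᶠ x in nhds ctp, F x = F ctp - |psip x| ^ lp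
  hpsimC2 : ContDiff ℝ 2 psim
  hpsimBij : Function.Bijective psim
  hpsimD : ∀ x, deriv psim x ≠ 0
  hpsim0 : psim ctm = 0
  hpsimEq : ∀ᶠ x in nhds ctm, F x = F ctm + |psim x| ^ lm
  hdtp : dtp ∈ Set.Ioo ctm (ctp + 1)
  hdtpF : F dtp = F ctp
  hFp1 : ∀ x ∈ Set.Icc ctp dtp, Fp x = F ctp
  hFp2 : ∀ x ∈ Set.Icc dtp (ctp + 1), Fp x = F x
  hdtm : dtm ∈ Set.Ioo (ctm - 1) ctp
  hdtmF : F dtm = F ctm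
  hFm1 : ∀ x ∈ Set.Icc dtm ctm, Fm x = F ctm
  hFm2 : ∀ x ∈ Set.Icc ctm (dtm + 1), Fm x = F x
  hirrp : Irrational Fp.translationNumber
  hirrm : Irrational Fm.translationNumber

namespace BimodA12Data

/-- The critical point `c⁺ = π(c̃⁺)`. -/
noncomputable def cp (B : BimodA12Data) : UnitAddCircle := ((B.ctp : ℝ) : UnitAddCircle)

/-- The critical point `c⁻ = π(c̃⁻)`. -/
noncomputable def cm (B : BimodA12Data) : UnitAddCircle := ((B.ctm : ℝ) : UnitAddCircle)

/-- The interval `𝕀 = π([c̃⁺, c̃⁻])` on which `f` is decreasing. -/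
def II (B : BimodA12Data) : Set UnitAddCircle :=
  (fun x : ℝ => ((x : ℝ) : UnitAddCircle)) '' Set.Icc B.ctp B.ctm

/-- The upper rotation number `ρ⁺`. -/
noncomputable def rhop (B : BimodA12Data) : ℝ := B.Fp.translationNumber

/-- The lower rotation number `ρ⁻`. -/
noncomputable def rhom (B : BimodA12Data) : ℝ := B.Fm.translationNumber

end BimodA12Data

/-! ### Continued fractions -/

/-- Numerators of the convergents of `ρ`. -/
def cfP (ρ : ℝ) : ℕ → ℤ
  | 0 => ⌊ρ⌋
  | 1 => cfA ρ 1 * ⌊ρ⌋ + 1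
  | n + 2 => cfA ρ (n + 2) * cfP ρ (n + 1) + cfP ρ n

/-- The signed approximation error `q_k ρ - p_k`. -/
def cfD (ρ : ℝ) (k : ℕ) : ℝ := cfQ ρ k * ρ - cfP ρ k

lemma irrational_cfFrac {ρ : ℝ} (h : Irrational ρ) (k : ℕ) : Irrational (cfFrac ρ k) := by
  induction k with
  | zero =>
    rw [cfFrac, ← Int.self_sub_floor]
    exact h.sub_intCast _
  | succ n ih =>
    rw [cfFrac, ← Int.self_sub_floor, one_div]
    exact ih.inv.sub_intCast _

lemma cfFrac_pos {ρ : ℝ} (h : Irrational ρ) (k : ℕ) : 0 < cfFrac ρ k := by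
  have h0 : 0 ≤ cfFrac ρ k := by cases k <;> exact Int.fract_nonneg _
  exact lt_of_le_of_ne h0 (irrational_cfFrac h k).ne_zero.symm

lemma cfFrac_lt_one (ρ : ℝ) (k : ℕ) : cfFrac ρ k < 1 := by
  cases k <;> exact Int.fract_lt_one _

lemma one_le_cfA {ρ : ℝ} (h : Irrational ρ) (k : ℕ) : 1 ≤ cfA ρ (k + 1) := by
  rw [cfA, Int.le_floor]
  have := cfFrac_pos h k
  rw [Int.cast_one, le_div_iff₀ this]
  linarith [cfFrac_lt_one ρ k]

lemma cfA_toNat {ρ : ℝ} (h : Irrational ρ) (k : ℕ) :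
    (((cfA ρ (k + 1)).toNat : ℕ) : ℤ) = cfA ρ (k + 1) :=
  Int.toNat_of_nonneg (by linarith [one_le_cfA h k])

lemma cfQ_pos {ρ : ℝ} (h : Irrational ρ) (k : ℕ) : 0 < cfQ ρ k := by
  induction k using Nat.twoStepInduction with
  | zero => simp [cfQ]
  | one =>
    have h1 : 1 ≤ cfA ρ 1 := one_le_cfA h 0
    rw [cfQ]; omega
  | more n h0 _ => rw [cfQ]; positivity

lemma cfD_add_two {ρ : ℝ} (h : Irrational ρ) (k : ℕ) :
    cfD ρ (k + 2) = cfA ρ (k + 2) * cfD ρ (k + 1) + cfD ρ k := by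
  have h1 : (((cfA ρ (k + 2)).toNat : ℕ) : ℝ) = cfA ρ (k + 2) := by
    exact_mod_cast congrArg (Int.cast : ℤ → ℝ) (cfA_toNat h (k + 1))
  simp only [cfD, cfQ, cfP]
  push_cast
  rw [h1]
  ring

lemma cfA_add_cfFrac (ρ : ℝ) (k : ℕ) :
    (cfA ρ (k + 1) : ℝ) + cfFrac ρ (k + 1) = 1 / cfFrac ρ k := by
  rw [cfA, cfFrac]; exact Int.floor_add_fract _

lemma cfD_succ {ρ : ℝ} (h : Irrational ρ) (k : ℕ) :
    cfD ρ (k + 1) = -cfFrac ρ (k + 1) * cfD ρ k := by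
  induction k with
  | zero =>
    have h1 : (((cfA ρ 1).toNat : ℕ) : ℝ) = cfA ρ 1 := by
      exact_mod_cast congrArg (Int.cast : ℤ → ℝ) (cfA_toNat h 0)
    have h2 := cfA_add_cfFrac ρ 0
    have h3 : cfFrac ρ 0 = ρ - ⌊ρ⌋ := by rw [cfFrac, Int.self_sub_floor]
    have h4 := cfFrac_pos h 0
    rw [eq_div_iff h4.ne'] at h2
    simp only [cfD, cfQ, cfP, zero_add]
    push_cast
    rw [h1]
    rw [h3] at h2
    simp only [zero_add] at h2
    linear_combination h2
  | succ n ih =>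
    rw [cfD_add_two h]
    have h2 := cfA_add_cfFrac ρ (n + 1)
    have h4 := cfFrac_pos h (n + 1)
    rw [eq_div_iff h4.ne'] at h2
    rw [ih]
    linear_combination -cfD ρ n * h2

lemma cfD_sign {ρ : ℝ} (h : Irrational ρ) (n : ℕ) :
    0 < cfD ρ (2 * n) ∧ cfD ρ (2 * n + 1) < 0 := by
  have key : ∀ k, 0 < cfD ρ k → cfD ρ (k + 1) < 0 := fun k hk => by
    rw [cfD_succ h]; nlinarith [cfFrac_pos h (k + 1)]
  induction n with
  | zero =>
    have h0 : 0 < cfD ρ 0 := by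
      have := cfFrac_pos h 0
      rw [cfFrac, ← Int.self_sub_floor] at this
      simpa [cfD, cfQ, cfP] using this
    exact ⟨h0, key 0 h0⟩
  | succ n ih =>
    have h1 : 0 < cfD ρ (2 * (n + 1)) := by
      rw [show 2 * (n + 1) = 2 * n + 1 + 1 by ring, cfD_succ h]
      nlinarith [cfFrac_pos h (2 * n + 1 + 1), ih.2]
    exact ⟨h1, key _ h1⟩

lemma cfD_ne_zero {ρ : ℝ} (h : Irrational ρ) (k : ℕ) : cfD ρ k ≠ 0 := by
  rcases Nat.even_or_odd' k with ⟨n, rfl | rfl⟩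
  · exact (cfD_sign h n).1.ne'
  · exact (cfD_sign h n).2.ne

lemma abs_cfD_succ_lt {ρ : ℝ} (h : Irrational ρ) (k : ℕ) : |cfD ρ (k + 1)| < |cfD ρ k| := by
  rw [cfD_succ h, abs_mul, abs_neg, abs_of_pos (cfFrac_pos h _)]
  nlinarith [cfFrac_lt_one ρ (k + 1), abs_pos.2 (cfD_ne_zero h k)]

lemma abs_cfD_lt_one {ρ : ℝ} (h : Irrational ρ) (k : ℕ) : |cfD ρ k| < 1 := by
  induction k with
  | zero =>
    rw [abs_of_pos (by simpa using (cfD_sign h 0).1)]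
    have := cfFrac_lt_one ρ 0
    rw [cfFrac, ← Int.self_sub_floor] at this
    simpa [cfD, cfQ, cfP] using this
  | succ k ih => exact (abs_cfD_succ_lt h k).trans ih

lemma cfD_mul_succ_neg {ρ : ℝ} (h : Irrational ρ) (k : ℕ) : cfD ρ k * cfD ρ (k + 1) < 0 := by
  rw [cfD_succ h]
  nlinarith [mul_pos (cfFrac_pos h (k + 1)) (mul_self_pos.2 (cfD_ne_zero h k))]

lemma cf_det {ρ : ℝ} (h : Irrational ρ) (k : ℕ) :
    (cfP ρ (k + 1) * cfQ ρ k - cfP ρ k * cfQ ρ (k + 1)) ^ 2 = 1 := by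
  induction k with
  | zero => simp only [cfP, cfQ]; rw [cfA_toNat h 0]; push_cast; ring
  | succ k ih =>
    rw [← ih]
    simp only [cfP, cfQ]
    push_cast
    rw [cfA_toNat h (k + 1)]
    ring

/-- Best approximation property of the convergents. -/
lemma abs_cfD_le {ρ : ℝ} (h : Irrational ρ) (m : ℕ) {k : ℤ} (hk : k ≠ 0)
    (hk' : |k| < cfQ ρ (m + 1)) (s : ℤ) : |cfD ρ m| ≤ |k * ρ - s| := by
  set e := cfP ρ (m + 1) * cfQ ρ m - cfP ρ m * cfQ ρ (m + 1) with he
  have hdet : e ^ 2 = 1 := cf_det h m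
  set x : ℤ := e * (cfP ρ (m + 1) * k - cfQ ρ (m + 1) * s)
  set y : ℤ := e * (cfQ ρ m * s - cfP ρ m * k)
  have hkx : k = x * cfQ ρ m + y * cfQ ρ (m + 1) := by
    simp only [x, y]; linear_combination (-k) * hdet + e * k * he
  have hsx : s = x * cfP ρ m + y * cfP ρ (m + 1) := by
    simp only [x, y]; linear_combination (-s) * hdet + e * s * he
  have hval : k * ρ - s = x * cfD ρ m + y * cfD ρ (m + 1) := by
    rw [hkx, hsx]; simp only [cfD]; push_cast; ring
  clear_value x y e
  have hq0 : (0 : ℤ) < cfQ ρ m := by exact_mod_cast cfQ_pos h m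
  have hq1 : (0 : ℤ) < cfQ ρ (m + 1) := by exact_mod_cast cfQ_pos h (m + 1)
  rw [abs_lt] at hk'
  have hx0 : x ≠ 0 := by
    rintro rfl
    rw [zero_mul, zero_add] at hkx
    rcases lt_trichotomy y 0 with hy | rfl | hy
    · nlinarith
    · simp_all
    · nlinarith
  have hxy : x * y ≤ 0 := by
    rcases lt_or_gt_of_ne hx0 with hx | hx
    · have : 0 ≤ y := by by_contra! hy; nlinarith
      nlinarith
    · have : y ≤ 0 := by by_contra! hy; nlinarith
      nlinarith
  have hxyR : (x : ℝ) * y ≤ 0 := by exact_mod_cast hxy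
  have hx1 : (1 : ℝ) ≤ (x : ℝ) ^ 2 := by
    have : 0 < x ^ 2 := by positivity
    exact_mod_cast this
  rw [hval]
  apply sq_le_sq.1
  have hD := cfD_mul_succ_neg h m
  nlinarith [sq_nonneg (y * cfD ρ (m + 1)), mul_nonneg_of_nonpos_of_nonpos hxyR hD.le,
    mul_nonneg (sub_nonneg.2 hx1) (sq_nonneg (cfD ρ m))]

/-! ### Monotone degree one lifts with a flat piece -/

/-- A monotone degree one lift `g`, constant on `[c, d]`, semiconjugate by `φ` to an irrational
translation, together with the one-step distortion bound outside the flat piece and the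
behaviour of `g` at both ends of the flat piece. -/
structure FlatLift where
  g : ℝ → ℝ
  φ : ℝ → ℝ
  (c d ρ ℓ K a₀ b₀ : ℝ)
  mono : Monotone g
  map_add_one : ∀ x, g (x + 1) = g x + 1
  surj : Function.Surjective g
  c_lt_d : c < d
  d_lt : d < c + 1
  flat : g c = g d
  irr : Irrational ρ
  one_lt : 1 < ℓ
  φ_mono : Monotone φ
  φ_add_one : ∀ x, φ (x + 1) = φ x + 1
  φ_g : ∀ x, φ (g x) = φ x + ρ
  strictMono : StrictMonoOn g (Icc d (c + 1))
  K_nonneg : 0 ≤ K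
  distortion : ∀ x y z w, d ≤ x → x ≤ y → y ≤ z → z ≤ w → w ≤ c + 1 →
    (g w - g z) * (y - x) ≤ Real.exp (K * (w - x)) * (w - z) * (g y - g x)
  a₀_pos : 0 < a₀
  b₀_pos : 0 < b₀
  left_lower : ∀ x ∈ Icc (d - 1) c, a₀ * (c - x) ^ ℓ ≤ g c - g x
  left_upper : ∀ x ∈ Icc (d - 1) c, g c - g x ≤ b₀ * (c - x) ^ ℓ
  right_lower : ∀ x ∈ Icc d (c + 1), a₀ * (x - d) ≤ g x - g c
  right_upper : ∀ x ∈ Icc d (c + 1), g x - g c ≤ b₀ * (x - d)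

section SumLengths

/-- Three reals in an interval of length `η > 0` are not pairwise `η`-separated. -/
lemma not_three_separated {η t a b c : ℝ} (hη : 0 < η) (ha : a ∈ Icc (t - η) t)
    (hb : b ∈ Icc (t - η) t) (hc : c ∈ Icc (t - η) t) (hab : η ≤ |a - b|) (hac : η ≤ |a - c|)
    (hbc : η ≤ |b - c|) : False := by
  obtain ⟨ha1, ha2⟩ := ha
  obtain ⟨hb1, hb2⟩ := hb
  obtain ⟨hc1, hc2⟩ := hc
  rcases le_abs.1 hab with h1 | h1 <;> rcases le_abs.1 hac with h2 | h2 <;>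
    rcases le_abs.1 hbc with h3 | h3 <;> linarith

lemma sum_length_le_of_card_le_two {ι : Type*} (S : Finset ι) (α β : ι → ℝ)
    (h0 : ∀ i ∈ S, 0 ≤ α i) (h2 : ∀ i ∈ S, β i ≤ 2) (hle : ∀ i ∈ S, α i ≤ β i)
    (hcard : ∀ x, ∀ i ∈ S, ∀ j ∈ S, ∀ k ∈ S, i ≠ j → i ≠ k → j ≠ k →
      x ∈ Icc (α i) (β i) → x ∈ Icc (α j) (β j) → x ∈ Icc (α k) (β k) → False) :
    ∑ i ∈ S, (β i - α i) ≤ 4 := by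
  classical
  have key : ∑ i ∈ S, volume (Icc (α i) (β i)) ≤ 4 := by
    calc ∑ i ∈ S, volume (Icc (α i) (β i))
        = ∑ i ∈ S, ∫⁻ x, (Icc (α i) (β i)).indicator 1 x := by
          refine Finset.sum_congr rfl fun i _ => ?_
          rw [lintegral_indicator_one measurableSet_Icc]
      _ = ∫⁻ x, ∑ i ∈ S, (Icc (α i) (β i)).indicator 1 x := by
          rw [lintegral_finsetSum]
          intro i _
          exact measurable_one.indicator measurableSet_Icc
      _ ≤ ∫⁻ x, (Icc (0 : ℝ) 2).indicator (fun _ => 2) x := by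
          refine lintegral_mono fun x => ?_
          have hsum : ∑ i ∈ S, (Icc (α i) (β i)).indicator (1 : ℝ → ENNReal) x
              = ((S.filter fun i => x ∈ Icc (α i) (β i)).card : ENNReal) := by
            simp only [indicator_apply, Pi.one_apply, Finset.sum_boole]
          rw [hsum]
          by_cases hx : x ∈ Icc (0 : ℝ) 2
          · rw [indicator_of_mem hx]
            have : (S.filter fun i => x ∈ Icc (α i) (β i)).card ≤ 2 := by
              by_contra! hlt
              obtain ⟨i, hi, j, hj, k, hk, hij, hik, hjk⟩ := Finset.two_lt_card.1 hlt
              rw [Finset.mem_filter] at hi hj hk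
              exact hcard x i hi.1 j hj.1 k hk.1 hij hik hjk hi.2 hj.2 hk.2
            exact (Nat.cast_le.2 this).trans_eq (by norm_num)
          · have : (S.filter fun i => x ∈ Icc (α i) (β i)) = ∅ := by
              refine Finset.filter_eq_empty_iff.2 fun i hi hxi => hx ?_
              exact ⟨(h0 i hi).trans hxi.1, hxi.2.trans (h2 i hi)⟩
            rw [this, Finset.card_empty, Nat.cast_zero]
            exact zero_le
      _ = 4 := by
          rw [lintegral_indicator measurableSet_Icc]
          simp only [lintegral_const, Measure.restrict_apply MeasurableSet.univ, univ_inter,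
            Real.volume_Icc, sub_zero]
          rw [ENNReal.ofReal_ofNat]
          norm_num
  have h3 : ∑ i ∈ S, volume (Icc (α i) (β i)) = ENNReal.ofReal (∑ i ∈ S, (β i - α i)) := by
    rw [ENNReal.ofReal_sum_of_nonneg fun i hi => sub_nonneg.2 (hle i hi)]
    simp [Real.volume_Icc]
  rw [h3, show (4 : ENNReal) = ENNReal.ofReal 4 by simp] at key
  exact (ENNReal.ofReal_le_ofReal_iff (by norm_num)).1 key

/-- Intervals of `φ`-length at most `η` with `η`-separated images under `φ` modulo `1` have
bounded total length. -/
lemma sum_length_le {ι : Type*} (S : Finset ι) (α β : ι → ℝ) {φ : ℝ → ℝ} {η : ℝ}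
    (hφ : Monotone φ) (hφ1 : ∀ x, φ (x + 1) = φ x + 1) (hη : 0 < η) (hη1 : η < 1)
    (hle : ∀ i ∈ S, α i ≤ β i) (hlen : ∀ i ∈ S, φ (β i) - φ (α i) ≤ η)
    (hsep : ∀ i ∈ S, ∀ j ∈ S, i ≠ j → ∀ s : ℤ, η ≤ |φ (α i) - φ (α j) - s|) :
    ∑ i ∈ S, (β i - α i) ≤ 4 := by
  have hφs : ∀ (s : ℤ) x, φ (x - s) = φ x - s := by
    have hnat : ∀ (n : ℕ) x, φ (x + n) = φ x + n := fun n => by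
      induction n with
      | zero => simp
      | succ n ih => intro x; push_cast; rw [← add_assoc, hφ1, ih, add_assoc]
    intro s x
    obtain ⟨n, rfl | rfl⟩ := s.eq_nat_or_neg
    · have := hnat n (x - n)
      push_cast at this ⊢
      rw [sub_add_cancel] at this
      linarith
    · have := hnat n x
      push_cast
      rw [sub_neg_eq_add, sub_neg_eq_add, this]
  have hb : ∀ i ∈ S, β i < α i + 1 := fun i hi =>
    hφ.reflect_lt (by rw [hφ1]; linarith [hlen i hi])
  have := sum_length_le_of_card_le_two S (fun i => α i - ⌊α i⌋) (fun i => β i - ⌊α i⌋)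
    (fun i _ => sub_nonneg.2 (Int.floor_le _))
    (fun i hi => by linarith [hb i hi, Int.lt_floor_add_one (α i)])
    (fun i hi => by linarith [hle i hi]) ?_
  · simpa only [sub_sub_sub_cancel_right] using this
  · intro x i hi j hj k hk hij hik hjk hxi hxj hxk
    have hmem : ∀ i ∈ S, x ∈ Icc (α i - ⌊α i⌋) (β i - ⌊α i⌋) →
        φ (α i - ⌊α i⌋) ∈ Icc (φ x - η) (φ x) := fun i hi hx =>
      ⟨by have := hφ hx.2; rw [hφs] at this ⊢; linarith [hlen i hi], hφ hx.1⟩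
    have hsep' : ∀ i ∈ S, ∀ j ∈ S, i ≠ j → η ≤ |φ (α i - ⌊α i⌋) - φ (α j - ⌊α j⌋)| :=
      fun i hi j hj hij => by
        have := hsep i hi j hj hij (⌊α i⌋ - ⌊α j⌋)
        rw [hφs, hφs]
        convert this using 2
        push_cast; ring
    exact not_three_separated hη (hmem i hi hxi) (hmem j hj hxj) (hmem k hk hxk)
      (hsep' i hi j hj hij) (hsep' i hi k hk hik) (hsep' j hj k hk hjk)

end SumLengths

namespace FlatLift

variable (L : FlatLift)

lemma g_add_int (x : ℝ) (s : ℤ) : L.g (x + s) = L.g x + s := by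
  have hnat : ∀ (n : ℕ) x, L.g (x + n) = L.g x + n := fun n => by
    induction n with
    | zero => simp
    | succ n ih => intro x; push_cast; rw [← add_assoc, L.map_add_one, ih, add_assoc]
  obtain ⟨n, rfl | rfl⟩ := s.eq_nat_or_neg
  · exact_mod_cast hnat n x
  · have := hnat n (x + ((-n : ℤ) : ℝ))
    push_cast at this ⊢
    rw [neg_add_cancel_right] at this
    linarith

lemma φ_add_int (x : ℝ) (s : ℤ) : L.φ (x + s) = L.φ x + s := by
  have hnat : ∀ (n : ℕ) x, L.φ (x + n) = L.φ x + n := fun n => by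
    induction n with
    | zero => simp
    | succ n ih => intro x; push_cast; rw [← add_assoc, L.φ_add_one, ih, add_assoc]
  obtain ⟨n, rfl | rfl⟩ := s.eq_nat_or_neg
  · exact_mod_cast hnat n x
  · have := hnat n (x + ((-n : ℤ) : ℝ))
    push_cast at this ⊢
    rw [neg_add_cancel_right] at this
    linarith

lemma iter_add_int (n : ℕ) (x : ℝ) (s : ℤ) : L.g^[n] (x + s) = L.g^[n] x + s := by
  induction n generalizing x with
  | zero => rfl
  | succ n ih => rw [Function.iterate_succ_apply, g_add_int, ih, ← Function.iterate_succ_apply]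

lemma φ_iter (n : ℕ) (x : ℝ) : L.φ (L.g^[n] x) = L.φ x + n * L.ρ := by
  induction n with
  | zero => simp
  | succ n ih => rw [Function.iterate_succ_apply', L.φ_g, ih]; push_cast; ring

lemma φ_d : L.φ L.d = L.φ L.c := by
  have h := L.φ_g L.c
  rw [L.flat, L.φ_g] at h
  linarith

lemma lt_of_φ {x y : ℝ} (h : L.φ x < L.φ y) : x < y := L.φ_mono.reflect_lt h

/-- The closest return maps. -/
def G (k : ℕ) (x : ℝ) : ℝ := L.g^[cfQ L.ρ k] x - cfP L.ρ k

lemma φ_G (k : ℕ) (x : ℝ) : L.φ (L.G k x) = L.φ x + cfD L.ρ k := by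
  have := L.φ_add_int (L.g^[cfQ L.ρ k] x) (-cfP L.ρ k)
  push_cast at this
  rw [← sub_eq_add_neg] at this
  rw [G, this, φ_iter, cfD]; ring

lemma G_mono (k : ℕ) : Monotone (L.G k) := fun _ _ h =>
  sub_le_sub_right (L.mono.iterate _ h) _

lemma G_flat (k : ℕ) : L.G k L.d = L.G k L.c := by
  obtain ⟨q, hq⟩ := Nat.exists_eq_succ_of_ne_zero (cfQ_pos L.irr k).ne'
  rw [G, G, hq, Function.iterate_succ_apply, Function.iterate_succ_apply, L.flat]

lemma iter_sub_int (n : ℕ) (x : ℝ) (s : ℤ) : L.g^[n] (x - s) = L.g^[n] x - s := by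
  have := L.iter_add_int n x (-s)
  push_cast at this
  rwa [← sub_eq_add_neg, ← sub_eq_add_neg] at this

lemma G_comm (j k : ℕ) (x : ℝ) : L.G j (L.G k x) = L.G k (L.G j x) := by
  simp only [G, iter_sub_int, ← Function.iterate_add_apply]
  rw [add_comm (cfQ L.ρ j)]; ring

lemma G_iter (k n : ℕ) (x : ℝ) :
    (L.G k)^[n] x = L.g^[n * cfQ L.ρ k] x - ((n * cfP L.ρ k : ℤ) : ℝ) := by
  induction n with
  | zero => simp
  | succ n ih =>
    rw [Function.iterate_succ_apply', ih, G, iter_sub_int, ← Function.iterate_add_apply,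
      show cfQ L.ρ k + n * cfQ L.ρ k = (n + 1) * cfQ L.ρ k by ring]
    push_cast; ring

lemma G_add_two (k : ℕ) (x : ℝ) :
    L.G (k + 2) x = (L.G (k + 1))^[(cfA L.ρ (k + 2)).toNat] (L.G k x) := by
  rw [G_iter, G, G, iter_sub_int, ← Function.iterate_add_apply, cfQ, cfP, cfA_toNat L.irr (k + 1)]
  push_cast; ring

lemma G_surj (k : ℕ) : Function.Surjective (L.G k) := fun y => by
  obtain ⟨x, hx⟩ := L.surj.iterate (cfQ L.ρ k) (y + cfP L.ρ k)
  exact ⟨x, by rw [G, hx]; ring⟩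

/-- A preimage under the closest return map. -/
def pre (k : ℕ) (y : ℝ) : ℝ := (L.G_surj k y).choose

lemma G_pre (k : ℕ) (y : ℝ) : L.G k (L.pre k y) = y := (L.G_surj k y).choose_spec

lemma φ_pre (k : ℕ) (y : ℝ) : L.φ (L.pre k y) = L.φ y - cfD L.ρ k := by
  have := L.φ_G k (L.pre k y)
  rw [G_pre] at this
  linarith

lemma φ_G_iter (k n : ℕ) (x : ℝ) : L.φ ((L.G k)^[n] x) = L.φ x + n * cfD L.ρ k := by
  induction n with
  | zero => simp
  | succ n ih => rw [Function.iterate_succ_apply', φ_G, ih]; push_cast; ring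

/-! ### Distortion of closest returns -/

lemma distortion_add_int (s : ℤ) {x y z w : ℝ} (hx : L.d + s ≤ x) (hxy : x ≤ y) (hyz : y ≤ z)
    (hzw : z ≤ w) (hw : w ≤ L.c + 1 + s) :
    (L.g w - L.g z) * (y - x) ≤ Real.exp (L.K * (w - x)) * (w - z) * (L.g y - L.g x) := by
  have h := L.distortion (x - s) (y - s) (z - s) (w - s) (by linarith) (by linarith)
    (by linarith) (by linarith) (by linarith)
  have hg : ∀ t, L.g (t - s) = L.g t - s := fun t => L.iter_sub_int 1 t s
  simp only [hg, sub_sub_sub_cancel_right] at h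
  exact h

lemma g_lt_of_lt (s : ℤ) {x y : ℝ} (hx : L.d + s ≤ x) (hxy : x < y) (hy : y ≤ L.c + 1 + s) :
    L.g x < L.g y := by
  have h := L.strictMono (a := x - s) (b := y - s) ⟨by linarith, by linarith⟩
    ⟨by linarith, by linarith⟩ (by linarith)
  have hg : ∀ t, L.g (t - s) = L.g t - s := fun t => L.iter_sub_int 1 t s
  rw [hg, hg] at h
  linarith

lemma eq_cfQ_of_eq_cfD {ρ : ℝ} (h : Irrational ρ) (m : ℕ) {k : ℕ} {s : ℤ}
    (heq : k * ρ - s = cfD ρ m) : k = cfQ ρ m ∧ s = cfP ρ m := by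
  have h1 : ((k : ℤ) - cfQ ρ m : ℤ) * ρ = ((s - cfP ρ m : ℤ) : ℝ) := by
    rw [cfD] at heq; push_cast; linarith
  have h2 : (k : ℤ) - cfQ ρ m = 0 := by
    by_contra hne
    exact (h.intCast_mul hne).ne_int _ h1
  have h3 : s - cfP ρ m = 0 := by
    rw [h2] at h1
    have : ((s - cfP ρ m : ℤ) : ℝ) = 0 := by rw [← h1]; simp
    exact_mod_cast this
  omega

variable {L} in
lemma iter_mem (m : ℕ) {X W : ℝ} (hXφ : L.φ L.c - |cfD L.ρ m| ≤ L.φ X)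
    (hWφ : L.φ W ≤ L.φ L.c + |cfD L.ρ m|) (hX : 0 < cfD L.ρ m → L.d ≤ L.G m X)
    (hW : cfD L.ρ m < 0 → L.G m W ≤ L.c) {k : ℕ} (hk : 0 < k) (hk' : k < cfQ L.ρ (m + 1)) :
    L.d + ⌊k * L.ρ⌋ ≤ L.g^[k] X ∧ L.g^[k] W ≤ L.c + 1 + ⌊k * L.ρ⌋ := by
  have hba : ∀ s : ℤ, |cfD L.ρ m| ≤ |k * L.ρ - s| := fun s => by
    have := abs_cfD_le L.irr m (k := k) (by exact_mod_cast hk.ne')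
      (by rw [abs_of_nonneg (by positivity)]; exact_mod_cast hk') s
    exact_mod_cast this
  set s := ⌊k * L.ρ⌋
  have hs0 : 0 ≤ k * L.ρ - s := sub_nonneg.2 (Int.floor_le _)
  have hs1 : k * L.ρ - (s + 1) < 0 := sub_neg.2 (Int.lt_floor_add_one _)
  constructor
  · have h1 := hba s
    rw [abs_of_nonneg hs0] at h1
    rcases h1.lt_or_eq with h1 | h1
    · refine (L.lt_of_φ ?_).le
      rw [φ_add_int, φ_iter, φ_d]; linarith
    · rcases lt_or_gt_of_ne (cfD_ne_zero L.irr m) with hD | hD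
      · exfalso
        rw [abs_of_neg hD, cfD] at h1
        have h2 : ((k + cfQ L.ρ m : ℕ) : ℝ) * L.ρ = ((s + cfP L.ρ m : ℤ) : ℝ) := by
          push_cast; linarith
        exact (L.irr.natCast_mul (by omega)).ne_int _ h2
      · rw [abs_of_pos hD] at h1
        obtain ⟨rfl, h3⟩ := eq_cfQ_of_eq_cfD L.irr m h1.symm
        have := hX hD
        rw [G, ← h3] at this
        linarith
  · have h1 := hba (s + 1)
    push_cast at h1
    rw [abs_of_neg hs1] at h1
    rcases h1.lt_or_eq with h1 | h1
    · refine (L.lt_of_φ ?_).le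
      rw [φ_add_int, φ_add_one, φ_iter]; linarith
    · rcases lt_or_gt_of_ne (cfD_ne_zero L.irr m) with hD | hD
      · rw [abs_of_neg hD] at h1
        obtain ⟨rfl, h3⟩ := eq_cfQ_of_eq_cfD L.irr m (s := s + 1) (by push_cast; linarith)
        have := hW hD
        rw [G, ← h3] at this
        push_cast at this
        linarith
      · exfalso
        rw [abs_of_pos hD, cfD] at h1
        have h2 : ((k + cfQ L.ρ m : ℕ) : ℝ) * L.ρ = ((s + 1 + cfP L.ρ m : ℤ) : ℝ) := by
          push_cast; linarith
        exact (L.irr.natCast_mul (by omega)).ne_int _ h2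

lemma sum_iter_le (m : ℕ) {X W : ℝ} (hXc : X ≤ L.c) (hdW : L.d ≤ W)
    (hXφ : L.φ L.c - |cfD L.ρ m| ≤ L.φ X) (hWφ : L.φ W ≤ L.φ L.c + |cfD L.ρ m|) :
    ∑ k ∈ Finset.Ico 1 (cfQ L.ρ (m + 1)), (L.g^[k] W - L.g^[k] X) ≤ 8 := by
  have hη : 0 < |cfD L.ρ m| := abs_pos.2 (cfD_ne_zero L.irr m)
  have key : ∀ x y, x ≤ y → L.φ y - L.φ x ≤ |cfD L.ρ m| →
      ∑ k ∈ Finset.Ico 1 (cfQ L.ρ (m + 1)), (L.g^[k] y - L.g^[k] x) ≤ 4 := by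
    intro x y hxy hφ
    refine sum_length_le _ (fun k => L.g^[k] x) (fun k => L.g^[k] y) L.φ_mono L.φ_add_one
      hη (abs_cfD_lt_one L.irr m) (fun k _ => L.mono.iterate k hxy) (fun k _ => ?_) ?_
    · rw [φ_iter, φ_iter]; linarith
    · intro i hi j hj hij s
      rw [Finset.mem_Ico] at hi hj
      have := abs_cfD_le L.irr m (k := (i : ℤ) - j) (by omega) (by rw [abs_lt]; omega) s
      rw [φ_iter, φ_iter]
      convert this using 2
      push_cast; ring
  have h1 := key X L.c hXc (by linarith)
  have h2 := key L.d W hdW (by rw [φ_d]; linarith)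
  have h3 : ∀ k ∈ Finset.Ico 1 (cfQ L.ρ (m + 1)), L.g^[k] W - L.g^[k] X
      = (L.g^[k] L.c - L.g^[k] X) + (L.g^[k] W - L.g^[k] L.d) := fun k hk => by
    rw [Finset.mem_Ico] at hk
    obtain ⟨j, rfl⟩ := Nat.exists_eq_succ_of_ne_zero (by omega : k ≠ 0)
    rw [Function.iterate_succ_apply _ _ L.c, Function.iterate_succ_apply _ _ L.d, L.flat]
    ring
  rw [Finset.sum_congr rfl h3, Finset.sum_add_distrib]
  linarith

/-- Distortion bound for closest return maps, with the first iterate removed. -/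
lemma distortion_G (m : ℕ) {X W x y z w : ℝ} (hXc : X ≤ L.c) (hdW : L.d ≤ W)
    (hXφ : L.φ L.c - |cfD L.ρ m| ≤ L.φ X) (hWφ : L.φ W ≤ L.φ L.c + |cfD L.ρ m|)
    (hX : 0 < cfD L.ρ m → L.d ≤ L.G m X) (hW : cfD L.ρ m < 0 → L.G m W ≤ L.c)
    (hx : X ≤ x) (hxy : x ≤ y) (hyz : y ≤ z) (hzw : z ≤ w) (hw : w ≤ W) :
    (L.G (m + 1) w - L.G (m + 1) z) * (L.g y - L.g x)
      ≤ Real.exp (8 * L.K) * (L.g w - L.g z) * (L.G (m + 1) y - L.G (m + 1) x) := by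
  have hmem := fun {k} hk hk' => iter_mem m hXφ hWφ hX hW (k := k) hk hk'
  have hmi : ∀ k, Monotone (L.g^[k]) := fun k => L.mono.iterate k
  have hA : 0 ≤ L.g w - L.g z := sub_nonneg.2 (L.mono hzw)
  rcases (L.mono hxy).lt_or_eq with hlt | heq
  swap
  · rw [heq, sub_self, mul_zero]
    exact mul_nonneg (mul_nonneg (Real.exp_nonneg _) hA) (sub_nonneg.2 (L.G_mono _ hxy))
  have hpos : ∀ k, k + 1 ≤ cfQ L.ρ (m + 1) → L.g^[k + 1] x < L.g^[k + 1] y := by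
    intro k
    induction k with
    | zero => intro _; exact hlt
    | succ k ih =>
      intro hk
      rw [Function.iterate_succ_apply' _ (k + 1), Function.iterate_succ_apply' _ (k + 1)]
      obtain ⟨h1, h2⟩ := hmem (k := k + 1) (by omega) (by omega)
      exact L.g_lt_of_lt _ (h1.trans (hmi _ hx)) (ih (by omega))
        ((hmi _ (hyz.trans (hzw.trans hw))).trans h2)
  have main : ∀ k, k + 1 ≤ cfQ L.ρ (m + 1) →
      (L.g^[k + 1] w - L.g^[k + 1] z) * (L.g y - L.g x)
        ≤ Real.exp (L.K * ∑ j ∈ Finset.Ico 1 (k + 1), (L.g^[j] W - L.g^[j] X)) *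
          (L.g w - L.g z) * (L.g^[k + 1] y - L.g^[k + 1] x) := by
    intro k
    induction k with
    | zero => intro _; simp
    | succ k ih =>
      intro hk
      have ih' := ih (by omega)
      have hY := hpos k (by omega)
      obtain ⟨h1, h2⟩ := hmem (k := k + 1) (by omega) (by omega)
      have hqc := L.distortion_add_int _ (h1.trans (hmi _ hx)) (hmi _ hxy) (hmi _ hyz)
        (hmi _ hzw) ((hmi _ hw).trans h2)
      rw [← Function.iterate_succ_apply' L.g, ← Function.iterate_succ_apply' L.g,
        ← Function.iterate_succ_apply' L.g, ← Function.iterate_succ_apply' L.g] at hqc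
      rw [Finset.sum_Ico_succ_top (by omega : 1 ≤ k + 1), mul_add, Real.exp_add]
      have hexp : Real.exp (L.K * (L.g^[k + 1] w - L.g^[k + 1] x))
          ≤ Real.exp (L.K * (L.g^[k + 1] W - L.g^[k + 1] X)) :=
        Real.exp_le_exp.2 (mul_le_mul_of_nonneg_left
          (sub_le_sub (hmi _ hw) (hmi _ hx)) L.K_nonneg)
      set E := Real.exp (L.K * (L.g^[k + 1] W - L.g^[k + 1] X))
      set S := Real.exp (L.K * ∑ j ∈ Finset.Ico 1 (k + 1), (L.g^[j] W - L.g^[j] X))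
      have hS : 0 < S := Real.exp_pos _
      have hE : 0 < E := Real.exp_pos _
      have hY' : 0 ≤ L.g^[k + 1 + 1] y - L.g^[k + 1 + 1] x := sub_nonneg.2 (hmi _ hxy)
      have hA' : 0 ≤ L.g^[k + 1] w - L.g^[k + 1] z := sub_nonneg.2 (hmi _ hzw)
      have hqc' : (L.g^[k + 1 + 1] w - L.g^[k + 1 + 1] z) * (L.g^[k + 1] y - L.g^[k + 1] x)
          ≤ E * (L.g^[k + 1] w - L.g^[k + 1] z) * (L.g^[k + 1 + 1] y - L.g^[k + 1 + 1] x) :=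
        hqc.trans (mul_le_mul_of_nonneg_right (mul_le_mul_of_nonneg_right hexp hA') hY')
      refine le_of_mul_le_mul_right ?_ (sub_pos.2 hY)
      calc _ = (L.g^[k + 1 + 1] w - L.g^[k + 1 + 1] z) * (L.g^[k + 1] y - L.g^[k + 1] x) *
            (L.g y - L.g x) := by ring
        _ ≤ E * (L.g^[k + 1] w - L.g^[k + 1] z) * (L.g^[k + 1 + 1] y - L.g^[k + 1 + 1] x) *
            (L.g y - L.g x) := mul_le_mul_of_nonneg_right hqc' (sub_pos.2 hlt).le
        _ = E * (L.g^[k + 1 + 1] y - L.g^[k + 1 + 1] x) *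
            ((L.g^[k + 1] w - L.g^[k + 1] z) * (L.g y - L.g x)) := by ring
        _ ≤ E * (L.g^[k + 1 + 1] y - L.g^[k + 1 + 1] x) *
            (S * (L.g w - L.g z) * (L.g^[k + 1] y - L.g^[k + 1] x)) :=
          mul_le_mul_of_nonneg_left ih' (mul_nonneg hE.le hY')
        _ = _ := by ring
  obtain ⟨q, hq⟩ := Nat.exists_eq_succ_of_ne_zero (cfQ_pos L.irr (m + 1)).ne'
  have hfin := main q hq.ge
  rw [← Nat.succ_eq_add_one, ← hq] at hfin
  have hexp : Real.exp (L.K * ∑ j ∈ Finset.Ico 1 (cfQ L.ρ (m + 1)), (L.g^[j] W - L.g^[j] X))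
      ≤ Real.exp (8 * L.K) := by
    rw [mul_comm 8]
    exact Real.exp_le_exp.2 (mul_le_mul_of_nonneg_left (L.sum_iter_le m hXc hdW hXφ hWφ)
      L.K_nonneg)
  simp only [G, sub_sub_sub_cancel_right]
  exact hfin.trans (mul_le_mul_of_nonneg_right (mul_le_mul_of_nonneg_right hexp hA)
    (sub_nonneg.2 (hmi _ hxy)))

end FlatLift
namespace FlatLift

variable (L : FlatLift)

/-! ### Distances of closest returns to the flat piece -/

/-- Distance to `c` of the closest returns from the left. -/
def δ (n : ℕ) : ℝ := L.c - L.G (2 * n + 1) L.c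

/-- Distance to `d` of the closest returns from the right. -/
def ε (n : ℕ) : ℝ := L.G (2 * n) L.c - L.d

/-- The odd partial quotients, starting with index `3`. -/
def a (n : ℕ) : ℕ := (cfA L.ρ (2 * n + 3)).toNat

/-- Distance to `d` of the iterates of `c` under an even closest return map. -/
def e (n i : ℕ) : ℝ := (L.G (2 * n + 2))^[i] L.c - L.d

/-- Distance to `c` of the preimage of `d` under an even closest return map. -/
def u (n : ℕ) : ℝ := L.c - L.pre (2 * n) L.d

/-- The constant in the distortion bound for closest return maps. -/
def M : ℝ := Real.exp (8 * L.K)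

lemma one_le_M : 1 ≤ L.M := Real.one_le_exp (by linarith [L.K_nonneg])

lemma ℓ_pos : 0 < L.ℓ := by linarith [L.one_lt]

lemma δ_succ (n : ℕ) : L.δ (n + 1) = L.c - L.G (2 * n + 3) L.c := rfl

lemma ε_succ (n : ℕ) : L.ε (n + 1) = L.G (2 * n + 2) L.c - L.d := rfl

lemma e_one (n : ℕ) : L.e n 1 = L.ε (n + 1) := rfl

lemma u_succ (n : ℕ) : L.u (n + 1) = L.c - L.pre (2 * n + 2) L.d := rfl

lemma one_le_a (n : ℕ) : 1 ≤ L.a n := by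
  have : 1 ≤ cfA L.ρ (2 * n + 3) := one_le_cfA L.irr _
  rw [a]; omega

lemma cast_a (n : ℕ) : (L.a n : ℝ) = cfA L.ρ (2 * (n + 1) + 1) := by
  exact_mod_cast congrArg (Int.cast : ℤ → ℝ) (cfA_toNat L.irr (2 * n + 2))

lemma cfD_facts (n : ℕ) : 0 < cfD L.ρ (2 * n) ∧ cfD L.ρ (2 * n + 1) < 0 ∧
    0 < cfD L.ρ (2 * n + 2) ∧ cfD L.ρ (2 * n + 3) < 0 ∧
    0 < cfD L.ρ (2 * n) + cfD L.ρ (2 * n + 1) ∧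
    cfD L.ρ (2 * n + 1) + cfD L.ρ (2 * n + 2) < 0 ∧
    0 < cfD L.ρ (2 * n + 2) + cfD L.ρ (2 * n + 3) ∧ cfD L.ρ (2 * n) < 1 ∧
    cfD L.ρ (2 * n + 3) = L.a n * cfD L.ρ (2 * n + 2) + cfD L.ρ (2 * n + 1) := by
  obtain ⟨h0, h1⟩ := cfD_sign L.irr n
  obtain ⟨h2, h3⟩ : 0 < cfD L.ρ (2 * n + 2) ∧ cfD L.ρ (2 * n + 3) < 0 := cfD_sign L.irr (n + 1)
  have h4 := abs_cfD_succ_lt L.irr (2 * n)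
  have h5 := abs_cfD_succ_lt L.irr (2 * n + 1)
  have h6 := abs_cfD_succ_lt L.irr (2 * n + 2)
  have h7 := abs_cfD_lt_one L.irr (2 * n)
  rw [abs_of_neg h1, abs_of_pos h0] at h4
  rw [abs_of_pos h2, abs_of_neg h1] at h5
  rw [abs_of_neg h3, abs_of_pos h2] at h6
  rw [abs_of_pos h0] at h7
  refine ⟨h0, h1, h2, h3, by linarith, by linarith, by linarith, h7, ?_⟩
  rw [cast_a]
  exact cfD_add_two L.irr (2 * n + 1)

lemma φ_sub_one (x : ℝ) : L.φ (x - 1) = L.φ x - 1 := by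
  have := L.φ_add_one (x - 1)
  rw [sub_add_cancel] at this
  linarith

lemma le_G_even (n : ℕ) (x : ℝ) : x ≤ L.G (2 * n) x :=
  (L.lt_of_φ (by rw [φ_G]; linarith [(L.cfD_facts n).1])).le

lemma G_odd_le (n : ℕ) (x : ℝ) : L.G (2 * n + 1) x ≤ x :=
  (L.lt_of_φ (by rw [φ_G]; linarith [(L.cfD_facts n).2.1])).le

lemma le_G_even_iter (n i : ℕ) (x : ℝ) : x ≤ (L.G (2 * n))^[i] x := by
  induction i with
  | zero => rfl
  | succ i ih => rw [Function.iterate_succ_apply']; exact ih.trans (L.le_G_even n _)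

lemma G_iter_comm (j k i : ℕ) (x : ℝ) : L.G j ((L.G k)^[i] x) = (L.G k)^[i] (L.G j x) := by
  induction i with
  | zero => rfl
  | succ i ih => rw [Function.iterate_succ_apply', G_comm, ih, Function.iterate_succ_apply']

lemma G_odd_succ (n : ℕ) (x : ℝ) :
    L.G (2 * n + 3) x = L.G (2 * n + 1) ((L.G (2 * n + 2))^[L.a n] x) := by
  rw [G_iter_comm]; exact L.G_add_two (2 * n + 1) x

lemma G_odd_le_G_odd_pre (n : ℕ) :
    L.G (2 * n + 1) L.c ≤ L.G (2 * n + 3) (L.pre (2 * n + 2) L.d) := by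
  obtain ⟨b, hb⟩ := Nat.exists_eq_succ_of_ne_zero (by linarith [L.one_le_a n] : L.a n ≠ 0)
  rw [G_odd_succ, hb, Function.iterate_succ_apply, G_pre, ← G_flat]
  exact L.G_mono _ (L.le_G_even_iter (n + 1) b L.d)

lemma δ_pos (n : ℕ) : 0 < L.δ n :=
  sub_pos.2 (L.lt_of_φ (by rw [φ_G]; linarith [(L.cfD_facts n).2.1]))

lemma ε_pos (n : ℕ) : 0 < L.ε n :=
  sub_pos.2 (L.lt_of_φ (by rw [φ_G, φ_d]; linarith [(L.cfD_facts n).1]))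

lemma sub_one_lt_G_odd (n : ℕ) : L.d - 1 < L.G (2 * n + 1) L.c := by
  obtain ⟨h0, h1, -, -, h4, -, -, h7, -⟩ := L.cfD_facts n
  exact L.lt_of_φ (by rw [φ_G, φ_sub_one, φ_d]; linarith)

lemma G_even_lt (n : ℕ) : L.G (2 * n) L.c < L.c + 1 := by
  obtain ⟨h0, h1, -, -, h4, -, -, h7, -⟩ := L.cfD_facts n
  exact L.lt_of_φ (by rw [φ_G, φ_add_one]; linarith)

lemma δ_lt (n : ℕ) : L.δ n < 1 - (L.d - L.c) := by
  have := L.sub_one_lt_G_odd n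
  rw [δ]; linarith

lemma δ_lt_one (n : ℕ) : L.δ n < 1 := by linarith [L.δ_lt n, L.c_lt_d]

lemma ε_le_one (n : ℕ) : L.ε n ≤ 1 := by
  have := L.G_even_lt n
  rw [ε]; linarith [L.c_lt_d]

lemma sub_one_lt_pre (n : ℕ) : L.d - 1 < L.pre (2 * n) L.d := by
  obtain ⟨h0, h1, -, -, h4, -, -, h7, -⟩ := L.cfD_facts n
  exact L.lt_of_φ (by rw [φ_pre, φ_sub_one]; linarith)

lemma pre_lt (n : ℕ) : L.pre (2 * n) L.d < L.c := by
  obtain ⟨h0, h1, -, -, h4, -, -, h7, -⟩ := L.cfD_facts n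
  exact L.lt_of_φ (by rw [φ_pre, φ_d]; linarith)

lemma u_pos (n : ℕ) : 0 < L.u n := sub_pos.2 (L.pre_lt n)

lemma δ_le_u (n : ℕ) : L.δ n ≤ L.u n := by
  obtain ⟨h0, h1, -, -, h4, -, -, h7, -⟩ := L.cfD_facts n
  exact sub_le_sub_left (L.lt_of_φ (by rw [φ_G, φ_pre, φ_d]; linarith)).le _

lemma u_succ_le_δ (n : ℕ) : L.u (n + 1) ≤ L.δ n := by
  obtain ⟨h0, h1, h2, h3, h4, h5, h6, h7, h8⟩ := L.cfD_facts n
  exact sub_le_sub_left (L.lt_of_φ (by change _ < L.φ (L.pre (2 * n + 2) L.d); rw [φ_G, φ_pre, φ_d]; linarith)).le _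

lemma δ_antitone : Antitone L.δ :=
  antitone_nat_of_succ_le fun n => (L.δ_le_u (n + 1)).trans (L.u_succ_le_δ n)

lemma left_bounds_pre (n : ℕ) : L.a₀ * L.u n ^ L.ℓ ≤ L.g L.c - L.g (L.pre (2 * n) L.d) ∧
    L.g L.c - L.g (L.pre (2 * n) L.d) ≤ L.b₀ * L.u n ^ L.ℓ :=
  have h : L.pre (2 * n) L.d ∈ Icc (L.d - 1) L.c := ⟨(L.sub_one_lt_pre n).le, (L.pre_lt n).le⟩
  ⟨L.left_lower _ h, L.left_upper _ h⟩

lemma distortion_even (n : ℕ) {X W x y w : ℝ} (hXc : X ≤ L.c) (hdW : L.d ≤ W)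
    (hXφ : L.φ L.c + cfD L.ρ (2 * n + 1) ≤ L.φ X) (hWφ : L.φ W ≤ L.φ L.c - cfD L.ρ (2 * n + 1))
    (hW : L.G (2 * n + 1) W ≤ L.c)
    (hx : X ≤ x) (hxy : x ≤ y) (hyw : y ≤ w) (hw : w ≤ W) :
    (L.G (2 * n + 2) w - L.G (2 * n + 2) y) * (L.g y - L.g x)
      ≤ L.M * (L.g w - L.g y) * (L.G (2 * n + 2) y - L.G (2 * n + 2) x) := by
  have hD := (L.cfD_facts n).2.1
  exact L.distortion_G (2 * n + 1) hXc hdW (by rw [abs_of_neg hD]; linarith)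
    (by rw [abs_of_neg hD]; linarith) (fun h => absurd hD h.not_gt) (fun _ => hW) hx hxy le_rfl
    hyw hw

lemma distortion_odd (n : ℕ) {X W x y w : ℝ} (hXc : X ≤ L.c) (hdW : L.d ≤ W)
    (hXφ : L.φ L.c - cfD L.ρ (2 * n) ≤ L.φ X) (hWφ : L.φ W ≤ L.φ L.c + cfD L.ρ (2 * n))
    (hX : L.d ≤ L.G (2 * n) X)
    (hx : X ≤ x) (hxy : x ≤ y) (hyw : y ≤ w) (hw : w ≤ W) :
    (L.G (2 * n + 1) w - L.G (2 * n + 1) y) * (L.g y - L.g x)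
      ≤ L.M * (L.g w - L.g y) * (L.G (2 * n + 1) y - L.G (2 * n + 1) x) := by
  have hD := (L.cfD_facts n).1
  exact L.distortion_G (2 * n) hXc hdW (by rw [abs_of_pos hD]; linarith)
    (by rw [abs_of_pos hD]; linarith) (fun _ => hX) (fun h => absurd hD h.not_gt) hx hxy le_rfl
    hyw hw

/-! ### Estimates between consecutive scales -/

lemma exists_ε_mul_δ_le :
    ∃ C > 0, ∀ n, L.ε (n + 1) * L.δ n ^ L.ℓ ≤ C * L.u (n + 1) ^ L.ℓ := by
  have ha := L.a₀_pos
  have hb := L.b₀_pos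
  have hM := L.one_le_M
  set γ := L.d - L.c with hγ
  have hγ0 : 0 < γ := sub_pos.2 L.c_lt_d
  refine ⟨(γ + L.M) * L.b₀ * ((1 + L.M * γ) * L.b₀) / (γ * L.a₀ * L.a₀), by positivity,
    fun n => ?_⟩
  obtain ⟨h0, h1, h2, h3, h4, h5, h6, h7, h8⟩ := L.cfD_facts n
  set p := L.pre (2 * n + 2) L.d
  set p' := L.pre (2 * n + 2) L.c
  set A := L.G (2 * n + 1) L.c with hA
  have hAp : A ≤ p' := (L.lt_of_φ (by rw [φ_G, φ_pre]; linarith)).le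
  have hpp : p' ≤ p := by
    by_contra! h
    have := L.G_mono (2 * n + 2) h.le
    rw [G_pre, G_pre] at this
    exact this.not_gt L.c_lt_d
  have hpc : p ≤ L.c := (L.lt_of_φ (by rw [φ_pre, φ_d]; linarith)).le
  have hAc : A ≤ L.c := hAp.trans (hpp.trans hpc)
  have hAd := (L.sub_one_lt_G_odd n).le
  have hBp : L.G (2 * n + 2) p = L.d := L.G_pre _ _
  have hBp' : L.G (2 * n + 2) p' = L.c := L.G_pre _ _
  have hφA : L.φ L.c + cfD L.ρ (2 * n + 1) ≤ L.φ A := by rw [φ_G]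
  have hφd : L.φ L.d ≤ L.φ L.c - cfD L.ρ (2 * n + 1) := by rw [φ_d]; linarith
  have hAd' : L.G (2 * n + 1) L.d ≤ L.c := by rw [G_flat]; exact hAc
  have key1 := L.distortion_even n hAc le_rfl hφA hφd hAd' le_rfl hAp hpp (hpc.trans L.c_lt_d.le)
  have key2 := L.distortion_even n hAc le_rfl hφA hφd hAd' hAp hpp hpc L.c_lt_d.le
  rw [hBp, hBp'] at key1 key2
  have hBA : L.c - L.G (2 * n + 2) A ≤ 1 := by
    have : L.c - 1 < L.G (2 * n + 2) A := L.lt_of_φ (by rw [φ_sub_one, φ_G, φ_G]; linarith)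
    linarith
  have l1 := L.left_lower A ⟨hAd, hAc⟩
  have l2 := L.left_upper p' ⟨hAd.trans hAp, hpp.trans hpc⟩
  have l3 := L.left_lower p' ⟨hAd.trans hAp, hpp.trans hpc⟩
  have l4 := L.left_upper p ⟨hAd.trans (hAp.trans hpp), hpc⟩
  have m1 := L.mono hpp
  have m2 := L.mono hpc
  rw [u_succ, ε_succ]
  have hε : L.G (2 * n + 2) L.c - L.d ≤ 1 := L.ε_le_one (n + 1)
  have hε0 : 0 < L.G (2 * n + 2) L.c - L.d := L.ε_pos (n + 1)
  have hδ : L.δ n = L.c - A := rfl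
  rw [hδ]
  set E := L.G (2 * n + 2) L.c - L.d
  set U := (L.c - p) ^ L.ℓ
  set U' := (L.c - p') ^ L.ℓ
  set V := (L.c - A) ^ L.ℓ
  have r1 : γ * L.a₀ * V ≤ (γ + L.M) * L.b₀ * U' := by
    have s1 : L.M * (L.g p - L.g p') * (L.c - L.G (2 * n + 2) A) ≤ L.M * (L.b₀ * U') := by
      have t1 : L.M * (L.g p - L.g p') * (L.c - L.G (2 * n + 2) A)
        ≤ L.M * (L.g p - L.g p') * 1 :=
        mul_le_mul_of_nonneg_left hBA (mul_nonneg (by linarith) (by linarith))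
      have t2 : L.M * (L.g p - L.g p') ≤ L.M * (L.b₀ * U') :=
        mul_le_mul_of_nonneg_left (by linarith) (by linarith)
      linarith
    have s2 : γ * (L.a₀ * V - L.b₀ * U') ≤ γ * (L.g p' - L.g A) :=
      mul_le_mul_of_nonneg_left (by linarith) hγ0.le
    linarith
  have r2 : E * (L.a₀ * U') ≤ (1 + L.M * γ) * (L.b₀ * U) := by
    have s1 : E * (L.a₀ * U') ≤ E * (L.g L.c - L.g p') := mul_le_mul_of_nonneg_left l3 hε0.le
    have s2 : (1 + L.M * γ) * (L.g L.c - L.g p) ≤ (1 + L.M * γ) * (L.b₀ * U) :=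
      mul_le_mul_of_nonneg_left l4 (by positivity)
    have s3 : E * (L.g L.c - L.g p) ≤ 1 * (L.g L.c - L.g p) :=
      mul_le_mul_of_nonneg_right hε (by linarith)
    linarith
  rw [div_mul_eq_mul_div, le_div_iff₀ (by positivity)]
  calc E * V * (γ * L.a₀ * L.a₀) = E * L.a₀ * (γ * L.a₀ * V) := by ring
    _ ≤ E * L.a₀ * ((γ + L.M) * L.b₀ * U') := mul_le_mul_of_nonneg_left r1 (by positivity)
    _ = (γ + L.M) * L.b₀ * (E * (L.a₀ * U')) := by ring
    _ ≤ (γ + L.M) * L.b₀ * ((1 + L.M * γ) * (L.b₀ * U)) :=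
      mul_le_mul_of_nonneg_left r2 (by positivity)
    _ = _ := by ring

lemma exists_δ_rpow_mul_le : ∃ C > 0, ∀ n,
    L.δ (n + 1) ^ L.ℓ * L.δ (n + 1) ≤ C * (L.δ n - L.δ (n + 1)) := by
  have ha := L.a₀_pos
  have hb := L.b₀_pos
  have hM := L.one_le_M
  refine ⟨L.M * L.b₀ / L.a₀, by positivity, fun n => ?_⟩
  obtain ⟨h0, h1, h2, h3, h4, h5, h6, h7, h8⟩ := L.cfD_facts n
  set p := L.pre (2 * n + 2) L.d
  set v := L.pre (2 * n + 3) L.c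
  have hpc : p ≤ L.c := (L.pre_lt (n + 1)).le
  have hdv : L.d ≤ v := (L.lt_of_φ (by rw [φ_pre, φ_d]; linarith)).le
  have hv1 : v ≤ L.c + 1 := (L.lt_of_φ (by rw [φ_pre, φ_add_one]; linarith)).le
  have key := L.distortion_odd (n + 1) (X := p) (W := v) (x := p) (y := L.c) (w := v)
    hpc hdv (by rw [φ_pre, φ_d]; rfl)
    (by
      rw [φ_pre]
      have : cfD L.ρ (2 * (n + 1)) = cfD L.ρ (2 * n + 2) := rfl
      linarith)
    (L.G_pre _ _).ge le_rfl hpc (L.c_lt_d.le.trans hdv) le_rfl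
  rw [show 2 * (n + 1) + 1 = 2 * n + 3 by ring, L.G_pre, ← δ_succ] at key
  have l1 := (L.left_bounds_pre (n + 1)).1
  have l2 := L.right_upper v ⟨hdv, hv1⟩
  have hu : L.δ (n + 1) ^ L.ℓ ≤ L.u (n + 1) ^ L.ℓ :=
    Real.rpow_le_rpow (L.δ_pos _).le (L.δ_le_u _) L.ℓ_pos.le
  have hδ := L.δ_pos (n + 1)
  have hA := L.G_odd_le_G_odd_pre n
  have hd : L.G (2 * n + 3) L.c - L.G (2 * n + 3) p ≤ L.δ n - L.δ (n + 1) := by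
    rw [δ_succ, δ]; linarith
  have hd0 : 0 ≤ L.G (2 * n + 3) L.c - L.G (2 * n + 3) p := sub_nonneg.2 (L.G_mono _ hpc)
  have hgv : L.g v - L.g L.c ≤ L.b₀ := by nlinarith [L.c_lt_d]
  have hgv0 : 0 ≤ L.g v - L.g L.c := sub_nonneg.2 (L.mono (L.c_lt_d.le.trans hdv))
  rw [div_mul_eq_mul_div, le_div_iff₀ ha]
  calc L.δ (n + 1) ^ L.ℓ * L.δ (n + 1) * L.a₀
      = L.δ (n + 1) * (L.a₀ * L.δ (n + 1) ^ L.ℓ) := by ring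
    _ ≤ L.δ (n + 1) * (L.a₀ * L.u (n + 1) ^ L.ℓ) := by gcongr
    _ ≤ L.δ (n + 1) * (L.g L.c - L.g p) := mul_le_mul_of_nonneg_left l1 hδ.le
    _ ≤ _ := key
    _ ≤ L.M * L.b₀ * (L.δ n - L.δ (n + 1)) := by gcongr

lemma tendsto_δ : Tendsto L.δ atTop (nhds 0) := by
  obtain ⟨C, hC, h⟩ := L.exists_δ_rpow_mul_le
  obtain ⟨t, ht⟩ : ∃ t, Tendsto L.δ atTop (nhds t) :=
    ⟨_, tendsto_atTop_ciInf L.δ_antitone ⟨0, by rintro _ ⟨n, rfl⟩; exact (L.δ_pos n).le⟩⟩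
  have ht0 : 0 ≤ t := ge_of_tendsto' ht fun n => (L.δ_pos n).le
  have ht1 : Tendsto (fun n => L.δ (n + 1)) atTop (nhds t) := (tendsto_add_atTop_iff_nat 1).2 ht
  have hl : t ^ L.ℓ * t ≤ C * (t - t) :=
    le_of_tendsto_of_tendsto'
      ((ht1.rpow_const (Or.inr L.ℓ_pos.le)).mul ht1) ((ht.sub ht1).const_mul C) h
  rw [sub_self, mul_zero] at hl
  rcases ht0.lt_or_eq with h0 | h0
  · exact absurd hl (by positivity : 0 < t ^ L.ℓ * t).not_ge
  · rwa [← h0] at ht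

end FlatLift
namespace FlatLift

variable (L : FlatLift)

lemma e_pos (n : ℕ) {i : ℕ} (hi : 1 ≤ i) : 0 < L.e n i := by
  obtain ⟨h0, h1, h2, h3, h4, h5, h6, h7, h8⟩ := L.cfD_facts n
  have : (0 : ℝ) < i := by exact_mod_cast hi
  exact sub_pos.2 (L.lt_of_φ (by rw [φ_d, φ_G_iter]; nlinarith))

lemma e_mono (n : ℕ) : Monotone (L.e n) := monotone_nat_of_le_succ fun i => by
  rw [e, e, Function.iterate_succ_apply']
  exact sub_le_sub_right (L.le_G_even (n + 1) _) _

lemma G_iter_lt_pre (n : ℕ) {i : ℕ} (hi : i ≤ L.a n) :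
    (L.G (2 * n + 2))^[i] L.c < L.pre (2 * n + 1) L.c := by
  obtain ⟨h0, h1, h2, h3, h4, h5, h6, h7, h8⟩ := L.cfD_facts n
  have : (i : ℝ) * cfD L.ρ (2 * n + 2) ≤ L.a n * cfD L.ρ (2 * n + 2) :=
    mul_le_mul_of_nonneg_right (by exact_mod_cast hi) h2.le
  exact L.lt_of_φ (by rw [φ_G_iter, φ_pre]; linarith)

lemma d_le_pre_odd (n : ℕ) : L.d ≤ L.pre (2 * n + 1) L.c :=
  (L.lt_of_φ (by rw [φ_pre, φ_d]; linarith [(L.cfD_facts n).2.1])).le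

lemma pre_odd_le (n : ℕ) (y : ℝ) (hy : L.φ y = L.φ L.c) :
    L.pre (2 * n + 1) y ≤ L.G (2 * n) L.c := by
  obtain ⟨h0, h1, h2, h3, h4, h5, h6, h7, h8⟩ := L.cfD_facts n
  exact (L.lt_of_φ (by rw [φ_G, φ_pre, hy]; linarith)).le

lemma exists_pre_odd_le : ∃ C > 0, ∀ n,
    L.pre (2 * n + 1) L.c - L.d ≤ C * L.δ n * (L.pre (2 * n + 1) L.d - L.d) := by
  have ha := L.a₀_pos
  have hb := L.b₀_pos
  have hM := L.one_le_M
  have hγ0 : 0 < L.d - L.c := sub_pos.2 L.c_lt_d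
  refine ⟨L.M * L.b₀ / ((L.d - L.c) * L.a₀), by positivity, fun n => ?_⟩
  obtain ⟨h0, h1, h2, h3, h4, h5, h6, h7, h8⟩ := L.cfD_facts n
  set v := L.pre (2 * n + 1) L.c
  set v' := L.pre (2 * n + 1) L.d
  have hdv : L.d ≤ v := L.d_le_pre_odd n
  have hvv : v ≤ v' := by
    by_contra! h
    have := L.G_mono (2 * n + 1) h.le
    rw [G_pre, G_pre] at this
    exact this.not_gt L.c_lt_d
  have hv1 : v' ≤ L.c + 1 := (L.pre_odd_le n _ L.φ_d).trans (L.G_even_lt n).le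
  have key := L.distortion_odd n (X := L.c) (W := v') (x := L.c) (y := v) (w := v')
    le_rfl (hdv.trans hvv) (by linarith) (by rw [φ_pre, φ_d]; linarith)
    (sub_nonneg.1 (L.ε_pos n).le) le_rfl (L.c_lt_d.le.trans hdv) hvv le_rfl
  rw [G_pre, G_pre] at key
  have l1 := L.right_lower v ⟨hdv, hvv.trans hv1⟩
  have l2 := L.right_upper v' ⟨hdv.trans hvv, hv1⟩
  have hgv0 : 0 ≤ L.g v - L.g L.c := sub_nonneg.2 (L.mono (L.c_lt_d.le.trans hdv))
  have hδ := L.δ_pos n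
  rw [div_mul_eq_mul_div, div_mul_eq_mul_div, le_div_iff₀ (by positivity)]
  calc (v - L.d) * ((L.d - L.c) * L.a₀) = (L.d - L.c) * (L.a₀ * (v - L.d)) := by ring
    _ ≤ (L.d - L.c) * (L.g v - L.g L.c) := mul_le_mul_of_nonneg_left l1 hγ0.le
    _ ≤ L.M * (L.g v' - L.g v) * L.δ n := key
    _ ≤ L.M * (L.b₀ * (v' - L.d)) * L.δ n := by gcongr; linarith
    _ = _ := by ring

lemma exists_e_le : ∃ C > 0, ∀ n, L.e n (L.a n) ≤ C * L.δ n * L.ε n := by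
  obtain ⟨C, hC, h⟩ := L.exists_pre_odd_le
  refine ⟨C, hC, fun n => ?_⟩
  have h1 := L.G_iter_lt_pre n le_rfl
  have h2 := L.pre_odd_le n _ L.φ_d
  have h3 : C * L.δ n * (L.pre (2 * n + 1) L.d - L.d) ≤ C * L.δ n * L.ε n :=
    mul_le_mul_of_nonneg_left (by rw [ε]; linarith) (mul_pos hC (L.δ_pos n)).le
  have h4 := h n
  rw [e]
  linarith

lemma exists_g_sub_le : ∃ C > 0, ∀ n, C * L.δ n ≤ 1 → ∀ i < L.a n,
    L.g ((L.G (2 * n + 2))^[i] L.c) - L.g (L.pre (2 * n + 2) L.d) ≤ C * L.δ n * L.e n (i + 1) := by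
  obtain ⟨C, hC, hv⟩ := L.exists_pre_odd_le
  have ha := L.a₀_pos
  have hb := L.b₀_pos
  have hM := L.one_le_M
  refine ⟨2 * C + 2 * L.M * L.b₀ * C, by positivity, fun n hn i hi => ?_⟩
  obtain ⟨h0, h1, h2, h3, h4, h5, h6, h7, h8⟩ := L.cfD_facts n
  have hδ := L.δ_pos n
  have hv := hv n
  set p := L.pre (2 * n + 2) L.d
  set v := L.pre (2 * n + 1) L.c
  set v' := L.pre (2 * n + 1) L.d
  set B := L.G (2 * n + 2) with hB
  have hpc : p ≤ L.c := (L.pre_lt (n + 1)).le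
  have hdv : L.d ≤ v := L.d_le_pre_odd n
  have hci : L.c ≤ B^[i] L.c := L.le_G_even_iter (n + 1) i L.c
  have hiv : B^[i] L.c ≤ v := (L.G_iter_lt_pre n hi.le).le
  have hiv' : B^[i + 1] L.c ≤ v := (L.G_iter_lt_pre n hi).le
  have key := L.distortion_even n (X := p) (W := v) (x := p) (y := B^[i] L.c) (w := v) hpc hdv
    (by rw [φ_pre, φ_d]; linarith) (by rw [φ_pre]) (L.G_pre _ _).le le_rfl (hpc.trans hci) hiv
    le_rfl
  rw [← hB, ← Function.iterate_succ_apply' B, show B p = L.d from L.G_pre _ _] at key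
  have hBv : v' ≤ B v := (L.lt_of_φ (by rw [hB, φ_G, φ_pre, φ_pre, φ_d]; linarith)).le
  have hv1 : v ≤ L.c + 1 := (L.pre_odd_le n _ rfl).trans (L.G_even_lt n).le
  have l2 := L.right_upper v ⟨hdv, hv1⟩
  have hgi := L.mono hci
  have hgp := L.mono hpc
  have he : L.e n (i + 1) = B^[i + 1] L.c - L.d := rfl
  have he0 := L.e_pos n (Nat.le_add_left 1 i)
  rw [he] at he0 ⊢
  have hCδ : C * L.δ n ≤ 1 / 2 := by
    have : 0 < L.M * L.b₀ * C * L.δ n := by positivity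
    nlinarith
  have hv'0 : 0 < v' - L.d := by
    by_contra! h
    have : C * L.δ n * (v' - L.d) ≤ 0 := mul_nonpos_of_nonneg_of_nonpos (by positivity) h
    linarith
  have hvhalf : v - L.d ≤ (v' - L.d) / 2 := by
    have := mul_le_mul_of_nonneg_right hCδ hv'0.le
    linarith
  set e' := B^[i + 1] L.c - L.d with he'
  set Y := L.g (B^[i] L.c) - L.g p
  have hY : 0 ≤ Y := by simp only [Y]; linarith
  refine le_of_mul_le_mul_left ?_ (half_pos hv'0)
  calc (v' - L.d) / 2 * Y ≤ (B v - B^[i + 1] L.c) * Y := by gcongr; linarith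
    _ ≤ _ := key
    _ ≤ L.M * (L.b₀ * (C * L.δ n * (v' - L.d))) * e' := by
      gcongr
      have := mul_le_mul_of_nonneg_left hv hb.le
      linarith
    _ ≤ (v' - L.d) / 2 * ((2 * C + 2 * L.M * L.b₀ * C) * L.δ n * e') := by
      have : 0 ≤ (v' - L.d) * C * L.δ n * e' := by positivity
      linarith

lemma exists_u_rpow_le : ∃ C > 0, ∀ n, C * L.δ n ≤ 1 →
    L.u (n + 1) ^ L.ℓ ≤ C * L.δ n * L.ε (n + 1) := by
  obtain ⟨C, hC, h⟩ := L.exists_g_sub_le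
  have ha := L.a₀_pos
  refine ⟨C + C / L.a₀, by positivity, fun n hn => ?_⟩
  have hδ := L.δ_pos n
  have hε := L.ε_pos (n + 1)
  have h1 := h n (by have : 0 < C / L.a₀ * L.δ n := by positivity
                     linarith) 0 (L.one_le_a n)
  have h2 := (L.left_bounds_pre (n + 1)).1
  have h3 : L.a₀ * L.u (n + 1) ^ L.ℓ ≤ C * L.δ n * L.ε (n + 1) := h2.trans h1
  have h4 : L.u (n + 1) ^ L.ℓ ≤ C / L.a₀ * L.δ n * L.ε (n + 1) := by
    rw [div_mul_eq_mul_div, div_mul_eq_mul_div, le_div_iff₀ ha]; linarith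
  have : 0 < C * L.δ n * L.ε (n + 1) := by positivity
  linarith

lemma exists_e_le_e_succ : ∃ C > 0, ∀ n, C * L.δ n ≤ 1 → ∀ i, 1 ≤ i → i < L.a n →
    L.e n i ≤ C * L.δ n * L.e n (i + 1) := by
  obtain ⟨C, hC, h⟩ := L.exists_g_sub_le
  have ha := L.a₀_pos
  refine ⟨C + C / L.a₀, by positivity, fun n hn i hi hia => ?_⟩
  have hδ := L.δ_pos n
  have hε := L.e_pos n (Nat.le_add_left 1 i)
  have h1 := h n (by have : 0 < C / L.a₀ * L.δ n := by positivity
                     linarith) i hia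
  have hid : L.d ≤ (L.G (2 * n + 2))^[i] L.c := sub_nonneg.1 (L.e_pos n hi).le
  have hi1 : (L.G (2 * n + 2))^[i] L.c ≤ L.c + 1 := (L.G_iter_lt_pre n hia.le).le.trans
    ((L.pre_odd_le n _ rfl).trans (L.G_even_lt n).le)
  have h2 : L.a₀ * L.e n i ≤ L.g ((L.G (2 * n + 2))^[i] L.c) - L.g L.c :=
    L.right_lower _ ⟨hid, hi1⟩
  have h5 : L.g (L.pre (2 * n + 2) L.d) ≤ L.g L.c := L.mono (L.pre_lt (n + 1)).le
  have h3 : L.a₀ * L.e n i ≤ C * L.δ n * L.e n (i + 1) := by linarith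
  have h4 : L.e n i ≤ C / L.a₀ * L.δ n * L.e n (i + 1) := by
    rw [div_mul_eq_mul_div, div_mul_eq_mul_div, le_div_iff₀ ha]; linarith
  have : 0 < C * L.δ n * L.e n (i + 1) := by positivity
  linarith

lemma exists_e_succ_mul_le : ∃ C > 0, ∀ n, C * L.δ n ≤ 1 → ∀ i, 1 ≤ i → i < L.a n →
    L.e n (i + 1) * L.δ n ^ L.ℓ ≤ C * L.e n i := by
  obtain ⟨C, hC, h⟩ := L.exists_u_rpow_le
  obtain ⟨C', hC', h'⟩ := L.exists_ε_mul_δ_le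
  have ha := L.a₀_pos
  have hb := L.b₀_pos
  have hM := L.one_le_M
  refine ⟨C + C' * (C + L.M * L.b₀ / L.a₀), by positivity, fun n hn i hi hia => ?_⟩
  have hδ := L.δ_pos n
  have hδ1 := L.δ_lt_one n
  have hε := L.ε_pos (n + 1)
  have hei := L.e_pos n hi
  have hei' := L.e_pos n (Nat.le_add_left 1 i)
  obtain ⟨h0, h1, h2, h3, h4, h5, h6, h7, h8⟩ := L.cfD_facts n
  have hu := h n (by
    have : 0 < C' * (C + L.M * L.b₀ / L.a₀) * L.δ n := by positivity
    linarith)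
  have h'n := h' n
  set p := L.pre (2 * n + 2) L.d
  set B := L.G (2 * n + 2) with hB
  have hpc : p ≤ L.c := (L.pre_lt (n + 1)).le
  have hdv : L.d ≤ L.pre (2 * n + 1) L.c := L.d_le_pre_odd n
  have hci : L.c ≤ B^[i] L.c := L.le_G_even_iter (n + 1) i L.c
  have hiv := (L.G_iter_lt_pre n hia.le).le
  have key := L.distortion_even n (X := p) (W := L.pre (2 * n + 1) L.c) (x := p) (y := L.c)
    (w := B^[i] L.c) hpc hdv (by rw [φ_pre, φ_d]; linarith) (by rw [φ_pre]) (L.G_pre _ _).le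
    le_rfl hpc hci hiv
  have hid : L.d ≤ B^[i] L.c := sub_nonneg.1 hei.le
  have hi1 : B^[i] L.c ≤ L.c + 1 := hiv.trans ((L.pre_odd_le n _ rfl).trans (L.G_even_lt n).le)
  rw [← hB, ← Function.iterate_succ_apply' B, show B p = L.d from L.G_pre _ _] at key
  have key' : (L.e n (i + 1) - L.ε (n + 1)) * (L.g L.c - L.g p)
      ≤ L.M * (L.g (B^[i] L.c) - L.g L.c) * L.ε (n + 1) := by
    refine le_trans (le_of_eq ?_) key
    rw [ε_succ, e]; ring
  have l1 : L.a₀ * L.u (n + 1) ^ L.ℓ ≤ L.g L.c - L.g p := (L.left_bounds_pre (n + 1)).1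
  have l2 : L.g (B^[i] L.c) - L.g L.c ≤ L.b₀ * L.e n i := L.right_upper _ ⟨hid, hi1⟩
  have hεe : L.ε (n + 1) ≤ L.e n i := (L.e_one n).symm.trans_le (L.e_mono n hi)
  have hεe' : L.ε (n + 1) ≤ L.e n (i + 1) := hεe.trans (L.e_mono n (Nat.le_succ i))
  have huℓ : 0 < L.u (n + 1) ^ L.ℓ := Real.rpow_pos_of_pos (L.u_pos _) _
  set U := L.u (n + 1) ^ L.ℓ
  set E := L.ε (n + 1)
  have step : L.e n (i + 1) * U ≤ (C + L.M * L.b₀ / L.a₀) * L.e n i * E := by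
    have s1 : (L.e n (i + 1) - E) * (L.a₀ * U) ≤ L.M * (L.b₀ * L.e n i) * E :=
      calc (L.e n (i + 1) - E) * (L.a₀ * U) ≤ (L.e n (i + 1) - E) * (L.g L.c - L.g p) :=
            mul_le_mul_of_nonneg_left l1 (by linarith)
        _ ≤ _ := key'
        _ ≤ _ := by gcongr
    have s2 : (L.e n (i + 1) - E) * U ≤ L.M * L.b₀ / L.a₀ * L.e n i * E := by
      rw [div_mul_eq_mul_div, div_mul_eq_mul_div, le_div_iff₀ ha]; linarith
    have s3 : E * U ≤ C * L.e n i * E := by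
      have t1 : U ≤ C * L.e n i :=
        calc U ≤ C * L.δ n * E := hu
          _ ≤ C * 1 * L.e n i := by gcongr
          _ = _ := by ring
      calc E * U ≤ E * (C * L.e n i) := by gcongr
        _ = _ := by ring
    linarith
  have fin : L.e n (i + 1) * L.δ n ^ L.ℓ ≤ C' * (C + L.M * L.b₀ / L.a₀) * L.e n i := by
    refine le_of_mul_le_mul_right ?_ hε
    calc L.e n (i + 1) * L.δ n ^ L.ℓ * E = L.e n (i + 1) * (E * L.δ n ^ L.ℓ) := by ring
      _ ≤ L.e n (i + 1) * (C' * U) := by gcongr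
      _ = C' * (L.e n (i + 1) * U) := by ring
      _ ≤ C' * ((C + L.M * L.b₀ / L.a₀) * L.e n i * E) := by gcongr
      _ = _ := by ring
  have : 0 < C * L.e n i := by positivity
  linarith

lemma exists_u_rpow_mul_δ_le : ∃ C > 0, ∀ n,
    L.u (n + 1) ^ L.ℓ * L.δ (n + 1) ≤ C * L.δ (n + 1) ^ L.ℓ * L.δ n := by
  have ha := L.a₀_pos
  have hb := L.b₀_pos
  have hM := L.one_le_M
  have h2ℓ : (0 : ℝ) < 2 ^ L.ℓ := by positivity
  refine ⟨2 ^ L.ℓ + L.b₀ * (1 + L.M) * 2 ^ L.ℓ / L.a₀, by positivity, fun n => ?_⟩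
  obtain ⟨h0, h1, h2, h3, h4, h5, h6, h7, h8⟩ := L.cfD_facts n
  have hδ := L.δ_pos n
  have hδ' := L.δ_pos (n + 1)
  have hδδ := L.δ_antitone (Nat.le_succ n)
  have hδℓ : 0 < L.δ (n + 1) ^ L.ℓ := by positivity
  have htℓ : (2 * L.δ (n + 1)) ^ L.ℓ = 2 ^ L.ℓ * L.δ (n + 1) ^ L.ℓ :=
    Real.mul_rpow (by norm_num) hδ'.le
  rcases le_or_gt (2 * L.δ (n + 1)) (L.u (n + 1)) with hle | hgt
  · set p := L.pre (2 * n + 2) L.d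
    set t := 2 * L.δ (n + 1) with ht
    have hpc : p ≤ L.c := (L.pre_lt (n + 1)).le
    have hpt : p ≤ L.c - t := by rw [u_succ] at hle; linarith
    have htc : L.c - t ≤ L.c := by linarith
    have key := L.distortion_odd (n + 1) (X := p) (W := L.d) (x := p) (y := L.c - t) (w := L.c)
      hpc le_rfl (by rw [φ_pre, φ_d]; rfl) (by
        have : cfD L.ρ (2 * (n + 1)) = cfD L.ρ (2 * n + 2) := rfl
        rw [φ_d]; linarith) (L.G_pre _ _).ge le_rfl hpt htc L.c_lt_d.le
    rw [show 2 * (n + 1) + 1 = 2 * n + 3 by ring] at key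
    have hA := L.G_odd_le_G_odd_pre n
    have hAt : L.G (2 * n + 3) (L.c - t) ≤ L.c - t := L.G_odd_le (n + 1) _
    have hd : L.G (2 * n + 3) (L.c - t) - L.G (2 * n + 3) p ≤ L.δ n := by
      have := L.G_mono (2 * n + 3) htc
      have := L.δ_succ n
      rw [δ]; linarith
    have hd' : L.δ (n + 1) ≤ L.G (2 * n + 3) L.c - L.G (2 * n + 3) (L.c - t) := by
      have := L.δ_succ n
      linarith
    have l1 : L.a₀ * L.u (n + 1) ^ L.ℓ ≤ L.g L.c - L.g p := (L.left_bounds_pre (n + 1)).1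
    have l2 := L.left_upper (L.c - t) ⟨(L.sub_one_lt_pre (n + 1)).le.trans hpt, htc⟩
    rw [sub_sub_cancel, htℓ] at l2
    have hg1 := L.mono hpt
    have hg2 := L.mono htc
    set T := 2 ^ L.ℓ * L.δ (n + 1) ^ L.ℓ with hT
    have s1 : L.δ (n + 1) * (L.a₀ * L.u (n + 1) ^ L.ℓ - L.b₀ * T) ≤ L.M * (L.b₀ * T) * L.δ n :=
      calc _ ≤ L.δ (n + 1) * (L.g (L.c - t) - L.g p) :=
            mul_le_mul_of_nonneg_left (by linarith) hδ'.le
        _ ≤ (L.G (2 * n + 3) L.c - L.G (2 * n + 3) (L.c - t)) * (L.g (L.c - t) - L.g p) :=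
            mul_le_mul_of_nonneg_right hd' (by linarith)
        _ ≤ _ := key
        _ ≤ L.M * (L.g L.c - L.g (L.c - t)) * L.δ n :=
            mul_le_mul_of_nonneg_left hd (mul_nonneg (by linarith) (by linarith))
        _ ≤ _ := by gcongr
    have hT0 : 0 < T := by positivity
    have s2 : L.δ (n + 1) * (L.b₀ * T) ≤ L.δ n * (L.b₀ * T) := by gcongr
    have s3 : L.u (n + 1) ^ L.ℓ * L.δ (n + 1) ≤ L.b₀ * (1 + L.M) * T * L.δ n / L.a₀ := by
      rw [le_div_iff₀ ha]; linarith
    refine s3.trans ?_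
    have : 0 < T * L.δ n := by positivity
    calc L.b₀ * (1 + L.M) * T * L.δ n / L.a₀
        ≤ T * L.δ n + L.b₀ * (1 + L.M) * T * L.δ n / L.a₀ := by linarith
      _ = _ := by rw [hT]; field_simp
  · have s1 : L.u (n + 1) ^ L.ℓ ≤ 2 ^ L.ℓ * L.δ (n + 1) ^ L.ℓ := by
      rw [← htℓ]
      exact Real.rpow_le_rpow (L.u_pos _).le hgt.le L.ℓ_pos.le
    calc L.u (n + 1) ^ L.ℓ * L.δ (n + 1) ≤ 2 ^ L.ℓ * L.δ (n + 1) ^ L.ℓ * L.δ n := by gcongr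
      _ ≤ _ := by gcongr; linarith [show 0 < L.b₀ * (1 + L.M) * 2 ^ L.ℓ / L.a₀ by positivity]

lemma exists_δ_sub_mul_le : ∃ C > 0, ∀ n,
    (L.δ n - L.δ (n + 1)) * L.δ n ^ L.ℓ ≤ C * L.e n (L.a n) := by
  have ha := L.a₀_pos
  have hb := L.b₀_pos
  have hM := L.one_le_M
  refine ⟨L.M * L.b₀ / L.a₀, by positivity, fun n => ?_⟩
  obtain ⟨h0, h1, h2, h3, h4, h5, h6, h7, h8⟩ := L.cfD_facts n
  set p := L.pre (2 * n) L.d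
  set w := (L.G (2 * n + 2))^[L.a n] L.c with hw
  have hpc : p ≤ L.c := (L.pre_lt n).le
  have he := L.e_pos n (L.one_le_a n)
  have hdw : L.d ≤ w := sub_nonneg.1 he.le
  have hw1 : w ≤ L.c + 1 := (L.G_iter_lt_pre n le_rfl).le.trans
    ((L.pre_odd_le n _ rfl).trans (L.G_even_lt n).le)
  have key := L.distortion_odd n (X := p) (W := w) (x := p) (y := L.c) (w := w) hpc hdw
    (by rw [φ_pre, φ_d]) (by rw [hw, φ_G_iter]; linarith) (L.G_pre _ _).ge le_rfl hpc
    (L.c_lt_d.le.trans hdw) le_rfl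
  rw [hw, ← G_odd_succ, ← hw] at key
  have key' : (L.δ n - L.δ (n + 1)) * (L.g L.c - L.g p)
      ≤ L.M * (L.g w - L.g L.c) * (L.G (2 * n + 1) L.c - L.G (2 * n + 1) p) := by
    refine le_trans (le_of_eq ?_) key
    rw [δ_succ, δ]; ring
  have hle1 : L.G (2 * n + 1) L.c - L.G (2 * n + 1) p ≤ 1 := by
    have : L.G (2 * n + 1) L.c < L.G (2 * n + 1) p + 1 :=
      L.lt_of_φ (by rw [φ_add_one, φ_G, φ_G, φ_pre, φ_d]; linarith)
    linarith
  have l1 := (L.left_bounds_pre n).1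
  have l2 : L.g w - L.g L.c ≤ L.b₀ * L.e n (L.a n) := L.right_upper w ⟨hdw, hw1⟩
  have hgw := L.mono (L.c_lt_d.le.trans hdw)
  have hδδ : 0 ≤ L.δ n - L.δ (n + 1) := sub_nonneg.2 (L.δ_antitone (Nat.le_succ n))
  rw [div_mul_eq_mul_div, le_div_iff₀ ha]
  calc (L.δ n - L.δ (n + 1)) * L.δ n ^ L.ℓ * L.a₀
      ≤ (L.δ n - L.δ (n + 1)) * L.u n ^ L.ℓ * L.a₀ := by
        gcongr
        · exact (L.δ_pos n).le
        · exact L.ℓ_pos.le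
        · exact L.δ_le_u n
    _ = (L.δ n - L.δ (n + 1)) * (L.a₀ * L.u n ^ L.ℓ) := by ring
    _ ≤ (L.δ n - L.δ (n + 1)) * (L.g L.c - L.g p) := mul_le_mul_of_nonneg_left l1 hδδ
    _ ≤ _ := key'
    _ ≤ L.M * (L.g w - L.g L.c) * 1 :=
        mul_le_mul_of_nonneg_left hle1 (mul_nonneg (by linarith) (by linarith))
    _ ≤ L.M * (L.b₀ * L.e n (L.a n)) * 1 := by gcongr
    _ = _ := by ring

end FlatLift
/-! ### Growth of perturbed products -/

lemma exists_le_of_eventually_le {x P : ℕ → ℝ} (hx : ∀ n, 0 < x n) (hP : ∀ n, 0 < P n) (N : ℕ)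
    (h : ∃ c > 0, ∀ n ≥ N, c * P n ≤ x n) : ∃ c > 0, ∀ n, c * P n ≤ x n := by
  induction N with
  | zero => simpa using h
  | succ N ih =>
    obtain ⟨c, hc, h⟩ := h
    refine ih ⟨min c (x N / P N), lt_min hc (div_pos (hx N) (hP N)), fun n hn => ?_⟩
    rcases hn.eq_or_lt with rfl | hn
    · rw [← le_div_iff₀ (hP N)]; exact min_le_right _ _
    · exact (mul_le_mul_of_nonneg_right (min_le_left _ _) (hP n).le).trans (h n hn)

lemma exists_prod_le {m R : ℕ → ℝ} {t C : ℝ} {N : ℕ} (ht : 1 < t) (hR : ∀ n, t ≤ R n)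
    (hC : 0 ≤ C) (hm : Tendsto m atTop atTop) (hrec : ∀ n ≥ N, R n * (m n - C) ≤ m (n + 1)) :
    ∃ c > 0, ∃ N', ∀ n ≥ N', c * ∏ k ∈ Finset.range n, R k ≤ m n := by
  have hR0 : ∀ n, 0 < R n := fun n => by linarith [hR n]
  set B := C * t / (t - 1) with hB
  have ht1 : 0 < t - 1 := by linarith
  have hBC : t * (B - C) = B := by rw [hB]; field_simp; ring
  have hB0 : 0 ≤ B := by positivity
  have hBC0 : 0 ≤ B - C := by nlinarith
  obtain ⟨N', hN'⟩ := (tendsto_atTop.1 hm (B + 1)).exists_forall_of_atTop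
  have hP : ∀ n, 0 < ∏ k ∈ Finset.range n, R k := fun n => Finset.prod_pos fun k _ => hR0 k
  set N₀ := max N N'
  refine ⟨(∏ k ∈ Finset.range N₀, R k)⁻¹, inv_pos.2 (hP _), N₀, fun n hn => ?_⟩
  suffices h : (∏ k ∈ Finset.range N₀, R k)⁻¹ * ∏ k ∈ Finset.range n, R k ≤ m n - B by linarith
  induction n, hn using Nat.le_induction with
  | base => rw [inv_mul_cancel₀ (hP _).ne']; linarith [hN' N₀ (le_max_right _ _)]
  | succ n hn ih =>
    have h1 := hrec n ((le_max_left _ _).trans hn)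
    have h2 : t * (B - C) ≤ R n * (B - C) := mul_le_mul_of_nonneg_right (hR n) hBC0
    rw [Finset.prod_range_succ, ← mul_assoc]
    have h3 := mul_le_mul_of_nonneg_right ih (hR0 n).le
    linarith

lemma exists_le_prod {x R : ℕ → ℝ} {t C : ℝ} {N : ℕ} (ht : 1 < t) (hR : ∀ n, t ≤ R n)
    (hC : 0 ≤ C) (hrec : ∀ n ≥ N, x (n + 1) ≤ R n * (x n + C)) (hx : ∀ n, 0 < x n) :
    ∃ c > 0, ∀ n, x n ≤ c * ∏ k ∈ Finset.range n, R k := by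
  have hR0 : ∀ n, 0 < R n := fun n => by linarith [hR n]
  set B := C * t / (t - 1) with hB
  have ht1 : 0 < t - 1 := by linarith
  have hBC : t * (B - C) = B := by rw [hB]; field_simp; ring
  have hB0 : 0 ≤ B := by positivity
  have hBC0 : 0 ≤ B - C := by nlinarith
  have hP : ∀ n, 0 < ∏ k ∈ Finset.range n, R k := fun n => Finset.prod_pos fun k _ => hR0 k
  have hmain : ∀ n ≥ N, x n + B
      ≤ (x N + B) * (∏ k ∈ Finset.range N, R k)⁻¹ * ∏ k ∈ Finset.range n, R k := by
    intro n hn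
    induction n, hn using Nat.le_induction with
    | base => rw [inv_mul_cancel_right₀ (hP _).ne']
    | succ n hn ih =>
      have h1 := hrec n hn
      have h2 : t * (B - C) ≤ R n * (B - C) := mul_le_mul_of_nonneg_right (hR n) hBC0
      rw [Finset.prod_range_succ, ← mul_assoc]
      have h3 := mul_le_mul_of_nonneg_right ih (hR0 n).le
      linarith
  have hxN : 0 < x N + B := by linarith [hx N]
  obtain ⟨c, hc, h⟩ := exists_le_of_eventually_le hP hx N
    ⟨((x N + B) * (∏ k ∈ Finset.range N, R k)⁻¹)⁻¹, by have := hP N; positivity, fun n hn => by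
      have := hP N
      rw [inv_mul_le_iff₀ (by positivity)]
      linarith [hmain n hn]⟩
  exact ⟨c⁻¹, inv_pos.2 hc, fun n => by rw [le_inv_mul_iff₀ hc]; exact h n⟩

namespace FlatLift

variable (L : FlatLift)

/-! ### Recursive estimates on a logarithmic scale -/

lemma exists_forall_δ_le (C : ℝ) : ∃ N, ∀ n ≥ N, C * L.δ n ≤ 1 := by
  have := L.tendsto_δ.const_mul C
  rw [mul_zero] at this
  exact ((this.eventually_lt_const one_pos).mono fun _ h => h.le).exists_forall_of_atTop

lemma exists_ε_succ_le : ∃ C > 0, ∃ N, ∀ n ≥ N, L.ε (n + 1) ≤ (C * L.δ n) ^ L.a n * L.ε n := by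
  obtain ⟨C, hC, h⟩ := L.exists_e_le
  obtain ⟨C', hC', h'⟩ := L.exists_e_le_e_succ
  obtain ⟨N, hN⟩ := L.exists_forall_δ_le C'
  refine ⟨max C C', lt_max_of_lt_left hC, N, fun n hn => ?_⟩
  have hδ := L.δ_pos n
  have hε := L.ε_pos n
  set D := max C C'
  have hD : 0 < D := lt_max_of_lt_left hC
  have hiter : ∀ j, j + 1 ≤ L.a n → L.e n 1 ≤ (D * L.δ n) ^ j * L.e n (j + 1) := by
    intro j
    induction j with
    | zero => intro _; simp
    | succ j ih =>
      intro hj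
      have h1 := h' n (hN n hn) (j + 1) (by omega) (by omega)
      have hpos := L.e_pos n (Nat.le_add_left 1 (j + 1))
      calc L.e n 1 ≤ (D * L.δ n) ^ j * L.e n (j + 1) := ih (by omega)
        _ ≤ (D * L.δ n) ^ j * (C' * L.δ n * L.e n (j + 1 + 1)) := by gcongr
        _ ≤ (D * L.δ n) ^ j * (D * L.δ n * L.e n (j + 1 + 1)) := by
          gcongr; exact le_max_right _ _
        _ = _ := by rw [pow_succ]; ring
  obtain ⟨b, hb⟩ := Nat.exists_eq_succ_of_ne_zero (by linarith [L.one_le_a n] : L.a n ≠ 0)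
  have h1 := hiter b hb.ge
  have h2 := h n
  rw [hb, Nat.succ_eq_add_one] at h2 ⊢
  rw [← e_one]
  calc L.e n 1 ≤ (D * L.δ n) ^ b * L.e n (b + 1) := h1
    _ ≤ (D * L.δ n) ^ b * (C * L.δ n * L.ε n) := by gcongr
    _ ≤ (D * L.δ n) ^ b * (D * L.δ n * L.ε n) := by gcongr; exact le_max_left _ _
    _ = _ := by rw [pow_succ]; ring

lemma exists_e_mul_le : ∃ C > 0, ∃ N, ∀ n ≥ N,
    L.e n (L.a n) * (L.δ n ^ L.ℓ) ^ (L.a n - 1) ≤ C ^ (L.a n - 1) * L.ε (n + 1) := by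
  obtain ⟨C, hC, h⟩ := L.exists_e_succ_mul_le
  obtain ⟨N, hN⟩ := L.exists_forall_δ_le C
  refine ⟨C, hC, N, fun n hn => ?_⟩
  have hδ : 0 < L.δ n ^ L.ℓ := Real.rpow_pos_of_pos (L.δ_pos n) _
  have hiter : ∀ j, j + 1 ≤ L.a n → L.e n (j + 1) * (L.δ n ^ L.ℓ) ^ j ≤ C ^ j * L.e n 1 := by
    intro j
    induction j with
    | zero => intro _; simp
    | succ j ih =>
      intro hj
      have h1 := h n (hN n hn) (j + 1) (by omega) (by omega)
      calc L.e n (j + 1 + 1) * (L.δ n ^ L.ℓ) ^ (j + 1)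
          = (L.e n (j + 1 + 1) * L.δ n ^ L.ℓ) * (L.δ n ^ L.ℓ) ^ j := by rw [pow_succ]; ring
        _ ≤ C * L.e n (j + 1) * (L.δ n ^ L.ℓ) ^ j := by gcongr
        _ = C * (L.e n (j + 1) * (L.δ n ^ L.ℓ) ^ j) := by ring
        _ ≤ C * (C ^ j * L.e n 1) := mul_le_mul_of_nonneg_left (ih (by omega)) hC.le
        _ = _ := by rw [pow_succ]; ring
  obtain ⟨b, hb⟩ := Nat.exists_eq_succ_of_ne_zero (by linarith [L.one_le_a n] : L.a n ≠ 0)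
  have := hiter b hb.ge
  rwa [hb, Nat.succ_eq_add_one, Nat.add_sub_cancel, ← e_one]

/-- Logarithmic closeness of returns to `c`. -/
def Λ (n : ℕ) : ℝ := -Real.log (L.δ n)

/-- Logarithmic closeness of returns to `d`. -/
def E (n : ℕ) : ℝ := -Real.log (L.ε n)

lemma Λ_pos (n : ℕ) : 0 < L.Λ n := neg_pos.2 (Real.log_neg (L.δ_pos n) (L.δ_lt_one n))

lemma E_nonneg (n : ℕ) : 0 ≤ L.E n :=
  neg_nonneg.2 (Real.log_nonpos (L.ε_pos n).le (L.ε_le_one n))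

lemma tendsto_Λ : Tendsto L.Λ atTop atTop := by
  refine tendsto_neg_atBot_atTop.comp (Real.tendsto_log_nhdsGT_zero.comp ?_)
  exact tendsto_nhdsWithin_iff.2 ⟨L.tendsto_δ, Eventually.of_forall fun n => L.δ_pos n⟩

lemma one_le_cast_a (n : ℕ) : (1 : ℝ) ≤ L.a n := by exact_mod_cast L.one_le_a n

lemma exists_lower_rec : ∃ C > 0, ∃ N, ∀ n ≥ N, L.E n + L.a n * (L.Λ n - C) ≤ L.E (n + 1) ∧
    L.Λ n + L.E (n + 1) - C ≤ L.ℓ * L.Λ (n + 1) := by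
  obtain ⟨C, hC, N, h⟩ := L.exists_ε_succ_le
  obtain ⟨C', hC', h'⟩ := L.exists_u_rpow_le
  obtain ⟨N', hN'⟩ := L.exists_forall_δ_le C'
  refine ⟨1 + |Real.log C| + |Real.log C'|, by positivity, max N N', fun n hn => ?_⟩
  have hδ := L.δ_pos n
  have hδ' := L.δ_pos (n + 1)
  have hε := L.ε_pos n
  have hε' := L.ε_pos (n + 1)
  have ha := L.one_le_cast_a n
  constructor
  · have h1 := Real.log_le_log hε' (h n ((le_max_left _ _).trans hn))
    rw [Real.log_mul (by positivity) hε.ne', Real.log_pow, Real.log_mul hC.ne' hδ.ne'] at h1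
    have h2 : (L.a n : ℝ) * Real.log C ≤ L.a n * (1 + |Real.log C| + |Real.log C'|) := by
      gcongr
      linarith [le_abs_self (Real.log C), abs_nonneg (Real.log C')]
    simp only [E, Λ]
    linarith
  · have h1 : L.δ (n + 1) ^ L.ℓ ≤ C' * L.δ n * L.ε (n + 1) :=
      (Real.rpow_le_rpow hδ'.le (L.δ_le_u _) L.ℓ_pos.le).trans
        (h' n (hN' n ((le_max_right _ _).trans hn)))
    have h2 := Real.log_le_log (by positivity) h1
    rw [Real.log_mul (by positivity) hε'.ne', Real.log_mul hC'.ne' hδ.ne',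
      Real.log_rpow hδ'] at h2
    simp only [E, Λ]
    linarith [le_abs_self (Real.log C'), abs_nonneg (Real.log C)]

lemma exists_upper_rec : ∃ C > 0, ∃ N, ∀ n ≥ N,
    (L.ℓ - 1) * L.Λ (n + 1) ≤ (L.ℓ - 1 + (L.ℓ + 1) * L.a n) * L.Λ n + C * L.a n := by
  obtain ⟨C, hC, N, h⟩ := L.exists_e_mul_le
  obtain ⟨C₁, hC₁, h₁⟩ := L.exists_δ_sub_mul_le
  obtain ⟨C₂, hC₂, h₂⟩ := L.exists_ε_mul_δ_le
  obtain ⟨C₃, hC₃, h₃⟩ := L.exists_u_rpow_mul_δ_le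
  have hℓ := L.one_lt
  refine ⟨L.ℓ * Real.log 2 + |Real.log C| + |Real.log C₁| + |Real.log C₂| + |Real.log C₃|,
    by positivity, N, fun n hn => ?_⟩
  have hδ := L.δ_pos n
  have hδ' := L.δ_pos (n + 1)
  have hε' := L.ε_pos (n + 1)
  have hu := L.u_pos (n + 1)
  have he := L.e_pos n (L.one_le_a n)
  have ha := L.one_le_cast_a n
  have hΛ := L.Λ_pos n
  have hlog2 : 0 < Real.log 2 := Real.log_pos one_lt_two
  have b0 := le_abs_self (Real.log C)
  have b1 := le_abs_self (Real.log C₁)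
  have b2 := le_abs_self (Real.log C₂)
  have b3 := le_abs_self (Real.log C₃)
  have n0 := abs_nonneg (Real.log C)
  have n1 := abs_nonneg (Real.log C₁)
  have n2 := abs_nonneg (Real.log C₂)
  have n3 := abs_nonneg (Real.log C₃)
  set S := L.ℓ * Real.log 2 + |Real.log C| + |Real.log C₁| + |Real.log C₂| + |Real.log C₃| with hS
  have hSa : S ≤ S * L.a n := le_mul_of_one_le_right (by positivity) ha
  rcases le_or_gt (L.δ n / 2) (L.δ (n + 1)) with hle | hgt
  · have h1 := Real.log_le_log (by positivity) hle
    rw [Real.log_div hδ.ne' two_ne_zero] at h1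
    have h2 : L.Λ (n + 1) ≤ L.Λ n + Real.log 2 := by simp only [Λ]; linarith
    have h3 : (L.ℓ - 1) * L.Λ (n + 1) ≤ (L.ℓ - 1) * (L.Λ n + Real.log 2) :=
      mul_le_mul_of_nonneg_left h2 (by linarith)
    have h4 : 0 ≤ (L.ℓ + 1) * L.a n * L.Λ n := by positivity
    have h5 : (L.ℓ - 1) * Real.log 2 ≤ S := by linarith
    linarith
  · have k1 : L.δ n / 2 * L.δ n ^ L.ℓ ≤ C₁ * L.e n (L.a n) :=
      (mul_le_mul_of_nonneg_right (by linarith) (by positivity)).trans (h₁ n)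
    have g1 := Real.log_le_log (by positivity) k1
    rw [Real.log_mul (by positivity) (by positivity), Real.log_div hδ.ne' two_ne_zero,
      Real.log_rpow hδ, Real.log_mul hC₁.ne' he.ne'] at g1
    have g2 := Real.log_le_log (by positivity) (h n hn)
    rw [Real.log_mul he.ne' (by positivity), Real.log_pow, Real.log_rpow hδ,
      Real.log_mul (by positivity) hε'.ne', Real.log_pow, Nat.cast_sub (L.one_le_a n),
      Nat.cast_one] at g2
    have g3 := Real.log_le_log (by positivity) (h₂ n)
    rw [Real.log_mul hε'.ne' (by positivity), Real.log_rpow hδ, Real.log_mul hC₂.ne'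
      (by positivity)] at g3
    have g4 := Real.log_le_log (by positivity) (h₃ n)
    rw [Real.log_mul (by positivity) hδ'.ne', Real.log_mul (by positivity) hδ.ne',
      Real.log_mul hC₃.ne' (by positivity), Real.log_rpow hδ'] at g4
    have g5 : ((L.a n : ℝ) - 1) * Real.log C ≤ (L.a n - 1) * |Real.log C| :=
      mul_le_mul_of_nonneg_left b0 (by linarith)
    have hSC : 0 ≤ S - |Real.log C| := by
      have : 0 < L.ℓ * Real.log 2 := by positivity
      linarith
    have g6 : (L.a n : ℝ) * |Real.log C| + (S - |Real.log C|) ≤ S * L.a n := by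
      nlinarith [mul_nonneg (sub_nonneg.2 ha) hSC]
    have g7 : L.ℓ * (L.a n : ℝ) * L.Λ n + L.Λ n ≤ (L.ℓ + 1) * L.a n * L.Λ n := by
      nlinarith [mul_nonneg (sub_nonneg.2 ha) hΛ.le]
    simp only [Λ] at *
    have hlog2' : Real.log 2 ≤ L.ℓ * Real.log 2 := le_mul_of_one_le_left hlog2.le hℓ.le
    linarith

lemma exists_prod_le_Λ :
    ∃ c > 0, ∀ n, c * ∏ k ∈ Finset.range n, (1 + (L.a k : ℝ) / L.ℓ) ≤ L.Λ n := by
  obtain ⟨C, hC, N, h⟩ := L.exists_lower_rec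
  have hℓ := L.one_lt
  have hℓ1 : 0 < L.ℓ - 1 := by linarith
  have hℓ0 := L.ℓ_pos
  have hE : Tendsto L.E atTop atTop := by
    refine (tendsto_add_atTop_iff_nat 1).1
      (tendsto_atTop_mono' _ ?_ (tendsto_atTop_add_const_right _ (-C) L.tendsto_Λ))
    filter_upwards [eventually_ge_atTop N, L.tendsto_Λ.eventually_ge_atTop C] with n hn hΛ
    have h1 := (h n hn).1
    have h2 : L.Λ n - C ≤ L.a n * (L.Λ n - C) :=
      le_mul_of_one_le_left (by linarith) (L.one_le_cast_a n)
    linarith [L.E_nonneg n]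
  set m : ℕ → ℝ := fun n => min (L.Λ n) (L.E n / (L.ℓ - 1)) with hm
  have hmt : Tendsto m atTop atTop := by
    refine tendsto_atTop.2 fun b => ?_
    filter_upwards [tendsto_atTop.1 L.tendsto_Λ b,
      tendsto_atTop.1 (hE.atTop_div_const hℓ1) b] with n h1 h2
    exact le_min h1 h2
  obtain ⟨N₁, hN₁⟩ := (tendsto_atTop.1 hmt C).exists_forall_of_atTop
  have hR : ∀ n, 1 + 1 / L.ℓ ≤ 1 + (L.a n : ℝ) / L.ℓ := fun n => by
    have := L.one_le_cast_a n
    gcongr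
  obtain ⟨c, hc, N', hN'⟩ := exists_prod_le (t := 1 + 1 / L.ℓ) (C := C) (N := max N N₁)
    (by have : 0 < 1 / L.ℓ := by positivity
        linarith) hR hC.le hmt fun n hn => by
      obtain ⟨h1, h2⟩ := h n ((le_max_left _ _).trans hn)
      have hmC := hN₁ n ((le_max_right _ _).trans hn)
      have m1 : m n ≤ L.Λ n := min_le_left _ _
      have m2 : (L.ℓ - 1) * m n ≤ L.E n := by
        rw [mul_comm, ← le_div_iff₀ hℓ1]; exact min_le_right _ _
      have ha := L.one_le_cast_a n
      have h3 : L.a n * (m n - C) ≤ L.a n * (L.Λ n - C) := by gcongr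
      have h4 : 0 ≤ L.a n * (m n - C) := mul_nonneg (by linarith) (by linarith)
      have hexp : (1 + (L.a n : ℝ) / L.ℓ) * (m n - C) * L.ℓ
          = L.ℓ * (m n - C) + L.a n * (m n - C) := by field_simp
      have hℓC : C ≤ L.ℓ * C := le_mul_of_one_le_left hC.le hℓ.le
      refine le_min ?_ ?_
      · refine le_of_mul_le_mul_right ?_ hℓ0
        rw [hexp]
        linarith
      · rw [le_div_iff₀ hℓ1]
        refine le_of_mul_le_mul_right ?_ hℓ0
        calc (1 + (L.a n : ℝ) / L.ℓ) * (m n - C) * (L.ℓ - 1) * L.ℓ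
            = (L.ℓ * (m n - C) + L.a n * (m n - C)) * (L.ℓ - 1) := by rw [← hexp]; ring
          _ ≤ L.E (n + 1) * L.ℓ := by nlinarith
  refine exists_le_of_eventually_le L.Λ_pos (fun n => Finset.prod_pos fun k _ => ?_) N'
    ⟨c, hc, fun n hn => (hN' n hn).trans (min_le_left _ _)⟩
  positivity

lemma exists_Λ_le_prod : ∃ C > 0, ∀ n,
    L.Λ n ≤ C * ∏ k ∈ Finset.range n, (1 + (L.ℓ + 1) / (L.ℓ - 1) * (L.a k : ℝ)) := by
  obtain ⟨C, hC, N, h⟩ := L.exists_upper_rec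
  have hℓ1 : 0 < L.ℓ - 1 := by linarith [L.one_lt]
  have hℓ0 := L.ℓ_pos
  refine exists_le_prod (t := 1 + (L.ℓ + 1) / (L.ℓ - 1)) (C := C / (L.ℓ + 1)) (N := N)
    (by have : 0 < (L.ℓ + 1) / (L.ℓ - 1) := by positivity
        linarith)
    (fun n => ?_) (by positivity) (fun n hn => ?_) L.Λ_pos
  · have := le_mul_of_one_le_right (by positivity : 0 ≤ (L.ℓ + 1) / (L.ℓ - 1)) (L.one_le_cast_a n)
    linarith
  · refine le_of_mul_le_mul_left ((h n hn).trans ?_) hℓ1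
    have hexp : (L.ℓ - 1) * ((1 + (L.ℓ + 1) / (L.ℓ - 1) * (L.a n : ℝ)) * (L.Λ n + C / (L.ℓ + 1)))
        = (L.ℓ - 1 + (L.ℓ + 1) * L.a n) * L.Λ n + C * L.a n + (L.ℓ - 1) * (C / (L.ℓ + 1)) := by
      field_simp
      ring
    rw [hexp]
    linarith [show 0 ≤ (L.ℓ - 1) * (C / (L.ℓ + 1)) by positivity]

end FlatLift

/-! ### From a bimodal endomorphism to its upper map -/

/-- A monotone degree one lift is semiconjugate to the translation by its translation number. -/
lemma CircleDeg1Lift.exists_semiconj_translation (f : CircleDeg1Lift) :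
    ∃ φ : ℝ → ℝ, Monotone φ ∧ (∀ x, φ (x + 1) = φ x + 1) ∧
      ∀ x, φ (f x) = φ x + f.translationNumber := by
  set τ := f.translationNumber with hτ
  set u : ℝ → ℕ → ℝ := fun x n => (f ^ n) x - n * τ with hu
  have hub : ∀ x n, u x n ≤ x + 1 := fun x n => by
    have h1 := (f ^ n).floor_sub_le_translationNumber x
    have h2 := Int.lt_floor_add_one ((f ^ n) x - x)
    rw [f.translationNumber_pow] at h1
    simp only [hu]
    linarith
  have hlb : ∀ x n, x - 1 ≤ u x n := fun x n => by
    have h1 := (f ^ n).translationNumber_le_ceil_sub x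
    have h2 := Int.ceil_lt_add_one ((f ^ n) x - x)
    rw [f.translationNumber_pow] at h1
    simp only [hu]
    linarith
  have hbdd : ∀ x, IsBoundedUnder (· ≤ ·) atTop (u x) := fun x =>
    isBoundedUnder_of ⟨x + 1, hub x⟩
  have hcob : ∀ x, IsCoboundedUnder (· ≤ ·) atTop (u x) := fun x =>
    (isBoundedUnder_of ⟨x - 1, hlb x⟩ : IsBoundedUnder (· ≥ ·) atTop (u x)).isCoboundedUnder_le
  refine ⟨fun x => limsup (u x) atTop, fun x y hxy => ?_, fun x => ?_, fun x => ?_⟩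
  · refine limsup_le_limsup (Eventually.of_forall fun n => ?_) (hcob x) (hbdd y)
    exact sub_le_sub_right ((f ^ n).monotone hxy) _
  · change limsup (u (x + 1)) atTop = limsup (u x) atTop + 1
    rw [← limsup_add_const atTop (u x) 1 (hbdd x) (hcob x)]
    refine congrArg (fun v => limsup v atTop) (funext fun n => ?_)
    simp only [hu, CircleDeg1Lift.map_add_one]
    ring
  · change limsup (u (f x)) atTop = limsup (u x) atTop + τ
    rw [← limsup_nat_add (u x) 1, ← limsup_add_const atTop (fun i => u x (i + 1)) τ
      (isBoundedUnder_of ⟨x + 1, fun i => hub x (i + 1)⟩)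
      (isBoundedUnder_of ⟨x - 1, fun i => hlb x (i + 1)⟩ :
        IsBoundedUnder (· ≥ ·) atTop fun i => u x (i + 1)).isCoboundedUnder_le]
    refine congrArg (fun v => limsup v atTop) (funext fun n => ?_)
    simp only [hu, pow_succ, CircleDeg1Lift.mul_apply]
    push_cast
    ring

/-- A positive continuous function on a compact set is bounded away from zero and infinity. -/
lemma IsCompact.exists_pos_bounds {s : Set ℝ} (hs : IsCompact s) {h : ℝ → ℝ}
    (hc : ContinuousOn h s) (hpos : ∀ x ∈ s, 0 < h x) :
    ∃ m > 0, ∃ M > 0, ∀ x ∈ s, m ≤ h x ∧ h x ≤ M := by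
  rcases s.eq_empty_or_nonempty with rfl | hne
  · exact ⟨1, one_pos, 1, one_pos, by simp⟩
  obtain ⟨p, hp, hmin⟩ := hs.exists_isMinOn hne hc
  obtain ⟨q, hq, hmax⟩ := hs.exists_isMaxOn hne hc
  exact ⟨h p, hpos p hp, h q, hpos q hq, fun x hx => ⟨hmin hx, hmax hx⟩⟩

/-- If `h'' ≤ K h'` on `(a, b)`, then difference quotients of `h` grow at most exponentially. -/
lemma mul_sub_le_exp_mul_of_deriv_le {h : ℝ → ℝ} (hC : ContDiff ℝ 2 h) {a b K : ℝ}
    (hK : ∀ x ∈ Ioo a b, deriv (deriv h) x ≤ K * deriv h x) (hK0 : 0 ≤ K)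
    (hpos : ∀ x ∈ Icc a b, 0 ≤ deriv h x) {x y z w : ℝ} (hax : a ≤ x) (hxy : x ≤ y)
    (hyz : y ≤ z) (hzw : z ≤ w) (hwb : w ≤ b) :
    (h w - h z) * (y - x) ≤ Real.exp (K * (w - x)) * (w - z) * (h y - h x) := by
  have hd1 : Differentiable ℝ h := hC.differentiable (by norm_num)
  have hC1 : ContDiff ℝ 1 (deriv h) := (contDiff_succ_iff_deriv (n := 1)).1 hC |>.2.2
  have hd2 : Differentiable ℝ (deriv h) := hC1.differentiable (by norm_num)
  have hanti : AntitoneOn (fun t => Real.exp (-K * t) * deriv h t) (Icc a b) := by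
    refine antitoneOn_of_deriv_nonpos (convex_Icc a b)
      (Continuous.continuousOn (.mul (by fun_prop) hd2.continuous))
      (Differentiable.differentiableOn (.mul (by fun_prop) hd2)) fun t ht => ?_
    rw [interior_Icc] at ht
    have h1 : HasDerivAt (fun t => Real.exp (-K * t)) (Real.exp (-K * t) * (-K)) t := by
      simpa using ((hasDerivAt_id t).const_mul (-K)).exp
    have h2 := h1.mul (hd2 t).hasDerivAt
    have h3 := h2.deriv
    rw [show (fun t => Real.exp (-K * t) * deriv h t) =
      (fun t => Real.exp (-K * t)) * deriv h from rfl, h3]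
    nlinarith [Real.exp_pos (-K * t), hK t ht]
  rcases hxy.eq_or_lt with rfl | hxy'
  · simp
  rcases hzw.eq_or_lt with rfl | hzw'
  · simp
  obtain ⟨s, hs, hs'⟩ := exists_deriv_eq_slope h hxy' hd1.continuous.continuousOn
    hd1.differentiableOn
  obtain ⟨t, ht, ht'⟩ := exists_deriv_eq_slope h hzw' hd1.continuous.continuousOn
    hd1.differentiableOn
  rw [eq_div_iff (sub_ne_zero.2 hxy'.ne')] at hs'
  rw [eq_div_iff (sub_ne_zero.2 hzw'.ne')] at ht'
  rw [← hs', ← ht']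
  have hsI : s ∈ Icc a b := ⟨by linarith [hs.1], by linarith [hs.2]⟩
  have htI : t ∈ Icc a b := ⟨by linarith [ht.1], by linarith [ht.2]⟩
  have key : deriv h t ≤ Real.exp (K * (w - x)) * deriv h s := by
    have h1 := hanti hsI htI (by linarith [hs.2, ht.1])
    simp only at h1
    have h2 : deriv h t ≤ Real.exp (K * (t - s)) * deriv h s := by
      have := mul_le_mul_of_nonneg_left h1 (Real.exp_pos (K * t)).le
      rw [← mul_assoc, ← mul_assoc, ← Real.exp_add, ← Real.exp_add] at this
      rw [show K * t + -K * t = 0 by ring, Real.exp_zero, one_mul] at this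
      rwa [show K * (t - s) = K * t + -K * s by ring]
    refine h2.trans (mul_le_mul_of_nonneg_right (Real.exp_le_exp.2 ?_) (hpos s hsI))
    exact mul_le_mul_of_nonneg_left (by linarith [hs.1, ht.2]) hK0
  have hpq : 0 ≤ (w - z) * (y - x) := mul_nonneg (by linarith) (by linarith)
  nlinarith [mul_le_mul_of_nonneg_right key hpq]

namespace BimodA12Data

variable (B : BimodA12Data)

lemma differentiable_F : Differentiable ℝ B.F := B.hC2.differentiable (by norm_num)

lemma contDiff_deriv_F : ContDiff ℝ 1 (deriv B.F) :=
  ((contDiff_succ_iff_deriv (n := 1)).1 B.hC2).2.2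

lemma deriv_F_add_one (x : ℝ) : deriv B.F (x + 1) = deriv B.F x := by
  rw [← deriv_comp_add_const, funext B.hlift, deriv_add_const]

lemma F_sub_one (x : ℝ) : B.F (x - 1) = B.F x - 1 := by
  have := B.hlift (x - 1)
  rw [sub_add_cancel] at this
  linarith

lemma deriv_F_pos {x : ℝ} (hx : x ∈ Ico (B.dtp - 1) B.ctp) : 0 < deriv B.F x := by
  rw [← B.deriv_F_add_one]
  exact B.hincr _ ⟨by linarith [hx.1, B.hdtp.1], by linarith [hx.2]⟩

lemma deriv_F_ctp : deriv B.F B.ctp = 0 := by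
  refine IsLocalMax.deriv_eq_zero ?_
  filter_upwards [B.hpsipEq] with x hx
  rw [hx]
  linarith [Real.rpow_nonneg (abs_nonneg (B.psip x)) B.lp]

lemma deriv_F_nonneg {x : ℝ} (hx : x ∈ Icc (B.dtp - 1) B.ctp) : 0 ≤ deriv B.F x := by
  rcases hx.2.eq_or_lt with rfl | h
  · exact B.deriv_F_ctp.ge
  · exact (B.deriv_F_pos ⟨hx.1, h⟩).le

lemma strictMonoOn_F : StrictMonoOn B.F (Icc B.dtp (B.ctp + 1)) :=
  strictMonoOn_of_deriv_pos (convex_Icc _ _) B.differentiable_F.continuous.continuousOn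
    fun x hx => by
      rw [interior_Icc] at hx
      exact B.hincr _ ⟨B.hdtp.1.trans hx.1, hx.2⟩

lemma strictMonoOn_F_left : StrictMonoOn B.F (Icc (B.dtp - 1) B.ctp) :=
  strictMonoOn_of_deriv_pos (convex_Icc _ _) B.differentiable_F.continuous.continuousOn
    fun x hx => by
      rw [interior_Icc] at hx
      exact B.deriv_F_pos ⟨hx.1.le, hx.2⟩

/-- A decreasing normal form for `F` to the left of `c⁺`. -/
lemma exists_normal_form : ∃ θ : ℝ → ℝ, ContDiff ℝ 2 θ ∧ θ B.ctp = 0 ∧ (∀ x, deriv θ x < 0) ∧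
    ∃ r > 0, B.dtp - 1 < B.ctp - r ∧ ∀ x ∈ Icc (B.ctp - r) B.ctp,
      B.F x = B.F B.ctp - θ x ^ B.lp := by
  obtain ⟨θ, hθ, h0, hneg, habs⟩ : ∃ θ : ℝ → ℝ, ContDiff ℝ 2 θ ∧ θ B.ctp = 0 ∧
      (∀ x, deriv θ x < 0) ∧ ∀ x, |θ x| = |B.psip x| := by
    have hd : Differentiable ℝ B.psip := B.hpsipC2.differentiable (by norm_num)
    rcases hasDerivWithinAt_forall_lt_or_forall_gt_of_forall_ne (convex_univ (𝕜 := ℝ) (E := ℝ))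
      (f := B.psip) (f' := deriv B.psip) (fun x _ => (hd x).hasDerivAt.hasDerivWithinAt)
      (m := 0) (fun x _ => B.hpsipD x) with h | h
    · exact ⟨B.psip, B.hpsipC2, B.hpsip0, fun x => h x trivial, fun _ => rfl⟩
    · refine ⟨-B.psip, B.hpsipC2.neg, by simp [B.hpsip0], fun x => ?_, fun x => by simp⟩
      rw [deriv.neg]
      exact neg_neg_of_pos (h x trivial)
  obtain ⟨s, hs, hball⟩ := Metric.eventually_nhds_iff.1 B.hpsipEq
  have hdc : 0 < B.ctp - (B.dtp - 1) := by linarith [B.hdtp.2]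
  set r := min (s / 2) ((B.ctp - (B.dtp - 1)) / 2) with hr
  have hr1 : r ≤ s / 2 := min_le_left _ _
  have hr2 : r ≤ (B.ctp - (B.dtp - 1)) / 2 := min_le_right _ _
  refine ⟨θ, hθ, h0, hneg, r, lt_min (by linarith) (by linarith), by linarith, fun x hx => ?_⟩
  have hθx : 0 ≤ θ x := h0 ▸ (strictAnti_of_deriv_neg hneg).antitone hx.2
  rw [hball (y := x), ← habs, abs_of_nonneg hθx]
  rw [Real.dist_eq, abs_lt]
  constructor <;> linarith [hx.1, hx.2]

lemma exists_deriv_deriv_le : ∃ K, 0 ≤ K ∧ ∀ x ∈ Ioo (B.dtp - 1) B.ctp,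
    deriv (deriv B.F) x ≤ K * deriv B.F x := by
  obtain ⟨θ, hθ, h0, hneg, r, hr, hrd, hF⟩ := B.exists_normal_form
  have hdθ : Differentiable ℝ θ := hθ.differentiable (by norm_num)
  have hCθ : ContDiff ℝ 1 (deriv θ) := ((contDiff_succ_iff_deriv (n := 1)).1 hθ).2.2
  have hddθ : Differentiable ℝ (deriv θ) := hCθ.differentiable (by norm_num)
  obtain ⟨K₁, hK₁⟩ := (isCompact_Icc (a := B.dtp - 1) (b := B.ctp - r)).exists_bound_of_continuousOn
    (f := fun x => deriv (deriv B.F) x / deriv B.F x)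
    ((B.contDiff_deriv_F.continuous_deriv le_rfl).continuousOn.div
      B.contDiff_deriv_F.continuous.continuousOn
      fun x hx => (B.deriv_F_pos ⟨hx.1, by linarith [hx.2]⟩).ne')
  obtain ⟨K₂, hK₂⟩ := (isCompact_Icc (a := B.ctp - r) (b := B.ctp)).exists_bound_of_continuousOn
    (f := fun x => deriv (deriv θ) x / deriv θ x)
    ((hCθ.continuous_deriv le_rfl).continuousOn.div hCθ.continuous.continuousOn
      fun x _ => (hneg x).ne)
  refine ⟨max 0 (max K₁ K₂), le_max_left _ _, fun x hx => ?_⟩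
  have hpos := B.deriv_F_pos ⟨hx.1.le, hx.2⟩
  rcases le_or_gt x (B.ctp - r) with hxr | hxr
  · have h1 := (le_abs_self _).trans (hK₁ x ⟨hx.1.le, hxr⟩)
    rw [div_le_iff₀ hpos] at h1
    refine h1.trans (mul_le_mul_of_nonneg_right ?_ hpos.le)
    exact (le_max_left _ _).trans (le_max_right _ _)
  · have hθpos : ∀ y ∈ Ioo (B.ctp - r) B.ctp, 0 < θ y := fun y hy =>
      h0 ▸ strictAnti_of_deriv_neg hneg hy.2
    have hd1 : ∀ y ∈ Ioo (B.ctp - r) B.ctp,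
        deriv B.F y = -(deriv θ y * B.lp * θ y ^ (B.lp - 1)) := fun y hy => by
      have h1 := ((hdθ y).hasDerivAt.rpow_const (p := B.lp) (.inl (hθpos y hy).ne')).const_sub
        (B.F B.ctp)
      refine (h1.congr_of_eventuallyEq ?_).deriv
      filter_upwards [Ioo_mem_nhds hy.1 hy.2] with z hz using hF z ⟨hz.1.le, hz.2.le⟩
    have hxI : x ∈ Ioo (B.ctp - r) B.ctp := ⟨hxr, hx.2⟩
    have hd2 : deriv (deriv B.F) x = -(deriv (deriv θ) x * B.lp * θ x ^ (B.lp - 1) +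
        deriv θ x * B.lp * (deriv θ x * (B.lp - 1) * θ x ^ (B.lp - 1 - 1))) := by
      have h1 := (((hddθ x).hasDerivAt.mul_const B.lp).mul
        ((hdθ x).hasDerivAt.rpow_const (p := B.lp - 1) (.inl (hθpos x hxI).ne'))).neg
      refine (h1.congr_of_eventuallyEq ?_).deriv
      filter_upwards [Ioo_mem_nhds hxI.1 hxI.2] with z hz using hd1 z hz
    have h1 := (le_abs_self _).trans (hK₂ x ⟨hxr.le, hx.2.le⟩)
    rw [div_le_iff_of_neg (hneg x)] at h1
    have h2 : deriv (deriv B.F) x ≤ K₂ * deriv B.F x := by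
      rw [hd2, hd1 x hxI]
      have e1 := Real.rpow_pos_of_pos (hθpos x hxI) (B.lp - 1)
      have e2 := Real.rpow_pos_of_pos (hθpos x hxI) (B.lp - 1 - 1)
      have hl := B.hlp
      have e3 : 0 ≤ B.lp * θ x ^ (B.lp - 1) := by positivity
      have e4 : 0 ≤ (deriv θ x) ^ 2 * (B.lp * (B.lp - 1) * θ x ^ (B.lp - 1 - 1)) :=
        mul_nonneg (sq_nonneg _) (mul_nonneg (mul_nonneg (by linarith) (by linarith)) e2.le)
      nlinarith [mul_le_mul_of_nonneg_right h1 e3]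
    refine h2.trans (mul_le_mul_of_nonneg_right ?_ hpos.le)
    exact (le_max_right _ _).trans (le_max_right _ _)

/-- `F` behaves like a power with exponent `ℓ⁺` on the left of `c⁺`. -/
lemma exists_left_bounds : ∃ m > 0, ∃ M > 0, ∀ x ∈ Icc (B.dtp - 1) B.ctp,
    m * (B.ctp - x) ^ B.lp ≤ B.F B.ctp - B.F x ∧
      B.F B.ctp - B.F x ≤ M * (B.ctp - x) ^ B.lp := by
  obtain ⟨θ, hθ, h0, hneg, r, hr, hrd, hF⟩ := B.exists_normal_form
  have hdθ : Differentiable ℝ θ := hθ.differentiable (by norm_num)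
  have hl := B.hlp
  have hDpos : ∀ x, 0 < -dslope θ B.ctp x := fun x => by
    rw [neg_pos]
    rcases lt_trichotomy x B.ctp with h | rfl | h
    · rw [dslope_of_ne _ h.ne, slope_def_field, h0, sub_zero]
      exact div_neg_of_pos_of_neg (h0 ▸ strictAnti_of_deriv_neg hneg h) (by linarith)
    · rw [dslope_same]
      exact hneg _
    · rw [dslope_of_ne _ h.ne', slope_def_field, h0, sub_zero]
      exact div_neg_of_neg_of_pos (h0 ▸ strictAnti_of_deriv_neg hneg h) (by linarith)
  have hDcont : Continuous (dslope θ B.ctp) := continuous_iff_continuousAt.2 fun x => by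
    rcases eq_or_ne x B.ctp with rfl | h
    · exact continuousAt_dslope_same.2 (hdθ _)
    · exact (continuousAt_dslope_of_ne h).2 hdθ.continuous.continuousAt
  obtain ⟨m₁, hm₁, M₁, hM₁, h₁⟩ := (isCompact_Icc (a := B.ctp - r) (b := B.ctp)).exists_pos_bounds
    (h := fun x => (-dslope θ B.ctp x) ^ B.lp)
    (hDcont.neg.rpow_const fun x => .inl (hDpos x).ne').continuousOn
    fun x _ => Real.rpow_pos_of_pos (hDpos x) _
  have hpw : ∀ x ∈ Icc (B.dtp - 1) (B.ctp - r), 0 < (B.ctp - x) ^ B.lp := fun x hx =>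
    Real.rpow_pos_of_pos (by linarith [hx.2]) _
  obtain ⟨m₂, hm₂, M₂, hM₂, h₂⟩ :=
    (isCompact_Icc (a := B.dtp - 1) (b := B.ctp - r)).exists_pos_bounds
    (h := fun x => (B.F B.ctp - B.F x) / (B.ctp - x) ^ B.lp)
    ((continuous_const.sub B.differentiable_F.continuous).continuousOn.div
      ((continuous_const.sub continuous_id).rpow_const fun x => .inr (by linarith)).continuousOn
      fun x hx => (hpw x hx).ne')
    fun x hx => div_pos (sub_pos.2 (B.strictMonoOn_F_left ⟨hx.1, by linarith [hx.2]⟩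
      ⟨by linarith, le_rfl⟩ (by linarith [hx.2]))) (hpw x hx)
  refine ⟨min m₁ m₂, lt_min hm₁ hm₂, max M₁ M₂, lt_max_of_lt_left hM₁, fun x hx => ?_⟩
  have hcx : 0 ≤ (B.ctp - x) ^ B.lp := Real.rpow_nonneg (by linarith [hx.2]) _
  rcases le_or_gt x (B.ctp - r) with hxr | hxr
  · obtain ⟨e1, e2⟩ := h₂ x ⟨hx.1, hxr⟩
    rw [le_div_iff₀ (hpw x ⟨hx.1, hxr⟩)] at e1
    rw [div_le_iff₀ (hpw x ⟨hx.1, hxr⟩)] at e2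
    exact ⟨(mul_le_mul_of_nonneg_right (min_le_right _ _) hcx).trans e1,
      e2.trans (mul_le_mul_of_nonneg_right (le_max_right _ _) hcx)⟩
  · obtain ⟨e1, e2⟩ := h₁ x ⟨hxr.le, hx.2⟩
    have hθx : θ x = -dslope θ B.ctp x * (B.ctp - x) := by
      have := sub_smul_dslope θ B.ctp x
      rw [h0, smul_eq_mul] at this
      linarith
    have hFx : B.F B.ctp - B.F x = (-dslope θ B.ctp x) ^ B.lp * (B.ctp - x) ^ B.lp := by
      rw [hF x ⟨hxr.le, hx.2⟩, hθx, Real.mul_rpow (hDpos x).le (by linarith [hx.2])]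
      ring
    rw [hFx]
    exact ⟨mul_le_mul_of_nonneg_right ((min_le_left _ _).trans e1) hcx,
      mul_le_mul_of_nonneg_right (e2.trans (le_max_left _ _)) hcx⟩

/-- `F` is bi-Lipschitz at the right end of the flat piece of the upper map. -/
lemma exists_right_bounds : ∃ m > 0, ∃ M > 0, ∀ x ∈ Icc B.dtp (B.ctp + 1),
    m * (x - B.dtp) ≤ B.F x - B.F B.ctp ∧ B.F x - B.F B.ctp ≤ M * (x - B.dtp) := by
  have hd := B.hdtp.2
  have hcont : Continuous (dslope B.F B.dtp) := continuous_iff_continuousAt.2 fun x => by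
    rcases eq_or_ne x B.dtp with rfl | h
    · exact continuousAt_dslope_same.2 (B.differentiable_F _)
    · exact (continuousAt_dslope_of_ne h).2 B.differentiable_F.continuous.continuousAt
  obtain ⟨m, hm, M, hM, h⟩ := (isCompact_Icc (a := B.dtp) (b := B.ctp + 1)).exists_pos_bounds
    (h := dslope B.F B.dtp) hcont.continuousOn fun x hx => by
      rcases hx.1.eq_or_lt with rfl | hlt
      · rw [dslope_same]
        exact B.hincr _ B.hdtp
      · rw [dslope_of_ne _ hlt.ne', slope_def_field]
        exact div_pos (sub_pos.2 (B.strictMonoOn_F ⟨le_rfl, hd.le⟩ hx hlt)) (by linarith)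
  refine ⟨m, hm, M, hM, fun x hx => ?_⟩
  have := sub_smul_dslope B.F B.dtp x
  rw [← B.hdtpF, ← this, smul_eq_mul, mul_comm (x - B.dtp)]
  have hx0 : 0 ≤ x - B.dtp := by linarith [hx.1]
  exact ⟨mul_le_mul_of_nonneg_right (h x hx).1 hx0, mul_le_mul_of_nonneg_right (h x hx).2 hx0⟩

end BimodA12Data

namespace BimodA12Data

variable (B : BimodA12Data)

lemma Fp_eq_F_left {x : ℝ} (hx : x ∈ Icc (B.dtp - 1) B.ctp) : B.Fp x = B.F x := by
  have h1 := B.hFp2 (x + 1) ⟨by linarith [hx.1], by linarith [hx.2]⟩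
  rw [B.Fp.map_add_one, B.hlift] at h1
  linarith

lemma F_add_int (x : ℝ) (s : ℤ) : B.F (x + s) = B.F x + s := by
  have hnat : ∀ (n : ℕ) x, B.F (x + n) = B.F x + n := fun n => by
    induction n with
    | zero => simp
    | succ n ih => intro x; push_cast; rw [← add_assoc, B.hlift, ih, add_assoc]
  obtain ⟨n, rfl | rfl⟩ := s.eq_nat_or_neg
  · exact_mod_cast hnat n x
  · have := hnat n (x + -n)
    rw [neg_add_cancel_right] at this
    push_cast
    linarith

lemma surjective_Fp : Function.Surjective B.Fp := by
  intro y
  have hd := B.hdtp.2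
  have hy : y - ⌊y - B.F B.ctp⌋ ∈ Icc (B.F B.dtp) (B.F (B.ctp + 1)) := by
    rw [B.hdtpF, B.hlift]
    constructor <;> linarith [Int.floor_le (y - B.F B.ctp), Int.lt_floor_add_one (y - B.F B.ctp)]
  obtain ⟨x, hx, hxy⟩ := intermediate_value_Icc hd.le
    B.differentiable_F.continuous.continuousOn hy
  refine ⟨x + ⌊y - B.F B.ctp⌋, ?_⟩
  rw [B.Fp.map_add_int, B.hFp2 x hx, hxy]
  ring

/-- The upper map is a monotone lift with a flat piece. -/
lemma exists_flatLift : ∃ L : FlatLift,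
    L.g = B.Fp ∧ L.c = B.ctp ∧ L.d = B.dtp ∧ L.ρ = B.rhop ∧ L.ℓ = B.lp := by
  obtain ⟨φ, hφ, hφ1, hφg⟩ := B.Fp.exists_semiconj_translation
  obtain ⟨K, hK0, hK⟩ := B.exists_deriv_deriv_le
  obtain ⟨m₁, hm₁, M₁, hM₁, h₁⟩ := B.exists_left_bounds
  obtain ⟨m₂, hm₂, M₂, hM₂, h₂⟩ := B.exists_right_bounds
  have hcd : B.ctp < B.dtp := B.h1.trans B.hdtp.1
  have hd := B.hdtp.2
  have hgc : B.Fp B.ctp = B.F B.ctp := B.hFp1 _ ⟨le_rfl, hcd.le⟩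
  have hpow : ∀ x ∈ Icc (B.dtp - 1) B.ctp, 0 ≤ (B.ctp - x) ^ B.lp := fun x hx =>
    Real.rpow_nonneg (by linarith [hx.2]) _
  refine ⟨{ g := B.Fp, φ := φ, c := B.ctp, d := B.dtp, ρ := B.rhop, ℓ := B.lp, K := K,
            a₀ := min m₁ m₂, b₀ := max M₁ M₂
            mono := B.Fp.monotone
            map_add_one := B.Fp.map_add_one
            surj := B.surjective_Fp
            c_lt_d := hcd
            d_lt := hd
            flat := by rw [hgc, B.hFp1 _ ⟨hcd.le, le_rfl⟩]
            irr := B.hirrp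
            one_lt := B.hlp
            φ_mono := hφ
            φ_add_one := hφ1
            φ_g := hφg
            strictMono := B.strictMonoOn_F.congr fun x hx => (B.hFp2 x hx).symm
            K_nonneg := hK0
            distortion := fun x y z w hdx hxy hyz hzw hwc => ?_
            a₀_pos := lt_min hm₁ hm₂
            b₀_pos := lt_max_of_lt_left hM₁
            left_lower := fun x hx => ?_
            left_upper := fun x hx => ?_
            right_lower := fun x hx => ?_
            right_upper := fun x hx => ?_ }, rfl, rfl, rfl, rfl, rfl⟩
  · have h := mul_sub_le_exp_mul_of_deriv_le B.hC2 hK hK0 (fun x hx => B.deriv_F_nonneg hx)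
      (x := x - 1) (y := y - 1) (z := z - 1) (w := w - 1) (by linarith) (by linarith)
      (by linarith) (by linarith) (by linarith)
    simp only [F_sub_one, sub_sub_sub_cancel_right] at h
    rwa [B.hFp2 x ⟨by linarith, by linarith⟩, B.hFp2 y ⟨by linarith, by linarith⟩,
      B.hFp2 z ⟨by linarith, by linarith⟩, B.hFp2 w ⟨by linarith, by linarith⟩]
  · rw [hgc, B.Fp_eq_F_left hx]
    exact (mul_le_mul_of_nonneg_right (min_le_left _ _) (hpow x hx)).trans (h₁ x hx).1
  · rw [hgc, B.Fp_eq_F_left hx]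
    exact (h₁ x hx).2.trans (mul_le_mul_of_nonneg_right (le_max_left _ _) (hpow x hx))
  · rw [hgc, B.hFp2 x hx]
    exact (mul_le_mul_of_nonneg_right (min_le_right _ _) (by linarith [hx.1])).trans (h₂ x hx).1
  · rw [hgc, B.hFp2 x hx]
    exact (h₂ x hx).2.trans (mul_le_mul_of_nonneg_right (le_max_right _ _) (by linarith [hx.1]))

variable {B}

/-- `F` agrees with the upper map away from the flat piece. -/
lemma F_eq_g {L : FlatLift} (hg : L.g = B.Fp) (hc : L.c = B.ctp) (hd : L.d = B.dtp) {y : ℝ}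
    (hy : ∀ s : ℤ, L.φ y ≠ L.φ L.c + s) : B.F y = L.g y := by
  have h1 := Int.floor_le (y - B.dtp)
  have h2 := Int.lt_floor_add_one (y - B.dtp)
  generalize ⌊y - B.dtp⌋ = s at h1 h2
  obtain ⟨x, rfl⟩ : ∃ x, y = x + s := ⟨y - s, by ring⟩
  rw [B.F_add_int, L.g_add_int]
  rcases le_or_gt x (B.ctp + 1) with h | h
  · rw [hg, B.hFp2 x ⟨by linarith, h⟩]
  · refine absurd (le_antisymm ?_ ?_ : L.φ x = L.φ L.c + 1) fun h3 => ?_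
    · rw [← L.φ_d, ← L.φ_add_one, hd]
      exact L.φ_mono (by linarith)
    · rw [← L.φ_add_one, hc]
      exact L.φ_mono h.le
    · refine hy (s + 1) ?_
      rw [L.φ_add_int, h3]
      push_cast
      ring

lemma iterate_cp {L : FlatLift} (hg : L.g = B.Fp) (hc : L.c = B.ctp) (hd : L.d = B.dtp) (n : ℕ) :
    B.f^[n] B.cp = ((L.g^[n] L.c : ℝ) : UnitAddCircle) := by
  induction n with
  | zero => rw [hc]; rfl
  | succ n ih =>
    rw [Function.iterate_succ_apply', Function.iterate_succ_apply', ih, B.hf]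
    congr 1
    rcases n.eq_zero_or_pos with rfl | hn
    · have hcd : B.ctp < B.dtp := B.h1.trans B.hdtp.1
      rw [Function.iterate_zero_apply, hg, hc, B.hFp1 _ ⟨le_rfl, hcd.le⟩]
    · refine F_eq_g hg hc hd fun s hs => ?_
      rw [L.φ_iter] at hs
      exact (L.irr.natCast_mul hn.ne').ne_int s (by linarith)

lemma dist_iterate_cp {L : FlatLift} (hg : L.g = B.Fp) (hc : L.c = B.ctp) (hd : L.d = B.dtp)
    (n : ℕ) : dist (B.f^[cfQ L.ρ (2 * n + 1)] B.cp) B.cp = min (L.δ n) (1 - L.δ n) := by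
  have h : L.g^[cfQ L.ρ (2 * n + 1)] L.c - B.ctp = -(L.δ n) + cfP L.ρ (2 * n + 1) := by
    rw [FlatLift.δ, FlatLift.G, hc]
    ring
  have h0 : ((cfP L.ρ (2 * n + 1) : ℝ) : UnitAddCircle) = 0 :=
    (AddCircle.coe_eq_zero_iff 1).2 ⟨cfP L.ρ (2 * n + 1), by simp⟩
  rw [iterate_cp hg hc hd, cp, dist_eq_norm, ← AddCircle.coe_sub, h, AddCircle.coe_add, h0,
    add_zero, AddCircle.coe_neg, norm_neg, UnitAddCircle.norm_eq, abs_sub_round_eq_min,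
    Int.fract_eq_self.2 ⟨(L.δ_pos n).le, L.δ_lt_one n⟩]

lemma abs_log_dist_bounds {L : FlatLift} (hg : L.g = B.Fp) (hc : L.c = B.ctp) (hd : L.d = B.dtp)
    (n : ℕ) : L.Λ n ≤ |Real.log (dist (B.f^[cfQ L.ρ (2 * n + 1)] B.cp) B.cp)| ∧
      |Real.log (dist (B.f^[cfQ L.ρ (2 * n + 1)] B.cp) B.cp)| ≤
        L.Λ n + -Real.log (L.d - L.c) := by
  rw [dist_iterate_cp hg hc hd]
  have hδ := L.δ_pos n
  have hδ1 := L.δ_lt_one n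
  have hgap : 0 < L.d - L.c := sub_pos.2 L.c_lt_d
  have hlo : (L.d - L.c) * L.δ n ≤ min (L.δ n) (1 - L.δ n) :=
    le_min (mul_le_of_le_one_left hδ.le (by linarith [L.d_lt]))
      ((mul_le_of_le_one_right hgap.le hδ1.le).trans (by linarith [L.δ_lt n]))
  have hpos : 0 < min (L.δ n) (1 - L.δ n) := lt_min hδ (by linarith)
  have hlog : Real.log (min (L.δ n) (1 - L.δ n)) ≤ Real.log (L.δ n) :=
    Real.log_le_log hpos (min_le_left _ _)
  have hlog' := Real.log_le_log (mul_pos hgap hδ) hlo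
  rw [Real.log_mul hgap.ne' hδ.ne'] at hlog'
  have hneg := Real.log_neg hδ hδ1
  rw [abs_of_neg (hlog.trans_lt hneg), FlatLift.Λ]
  exact ⟨by linarith, by linarith⟩

end BimodA12Data

lemma prod_Icc_one_eq_prod_range (u : ℕ → ℝ) (n : ℕ) :
    ∏ k ∈ Finset.Icc 1 n, u k = ∏ k ∈ Finset.range n, u (k + 1) := by
  induction n with
  | zero => simp
  | succ n ih => rw [Finset.prod_Icc_succ_top (by omega), Finset.prod_range_succ, ih]

/-- **Theorem (Graczyk's estimates).** For a degree one circle endomorphism satisfying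
(A1) and (A2), there is `C > 0` such that for all `n ≥ 1`,
`C⁻¹ Π_{0<k≤n} (1 + a⁺_{2k+1}/ℓ⁺) ≤ |log d(f^{q⁺_{2n+1}}(c⁺), c⁺)|
  ≤ C Π_{0<k≤n} (1 + ((ℓ⁺+1)/(ℓ⁺−1)) a⁺_{2k+1})`. -/
theorem graczyk_estimates (B : BimodA12Data) :
    ∃ C > (0 : ℝ), ∀ n : ℕ, 1 ≤ n →
      C⁻¹ * ∏ k ∈ Finset.Icc 1 n, (1 + (cfA B.rhop (2 * k + 1) : ℝ) / B.lp)
          ≤ |Real.log (dist (B.f^[cfQ B.rhop (2 * n + 1)] B.cp) B.cp)| ∧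
      |Real.log (dist (B.f^[cfQ B.rhop (2 * n + 1)] B.cp) B.cp)|
          ≤ C * ∏ k ∈ Finset.Icc 1 n,
              (1 + (B.lp + 1) / (B.lp - 1) * (cfA B.rhop (2 * k + 1) : ℝ)) := by
  obtain ⟨L, hg, hc, hd, hρ, hℓ⟩ := B.exists_flatLift
  obtain ⟨m, hm, hlow⟩ := L.exists_prod_le_Λ
  obtain ⟨M, hM, hup⟩ := L.exists_Λ_le_prod
  rw [← hρ, ← hℓ]
  have hκ : 0 ≤ -Real.log (L.d - L.c) := neg_nonneg.2 <|
    Real.log_nonpos (by linarith [L.c_lt_d]) (by linarith [L.d_lt])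
  have hl := L.one_lt
  refine ⟨max m⁻¹ (M + -Real.log (L.d - L.c)), lt_max_of_lt_left (inv_pos.2 hm), fun n _ => ?_⟩
  simp only [prod_Icc_one_eq_prod_range, ← L.cast_a]
  obtain ⟨h1, h2⟩ := BimodA12Data.abs_log_dist_bounds hg hc hd n
  constructor
  · refine le_trans (mul_le_mul_of_nonneg_right ?_ ?_) ((hlow n).trans h1)
    · exact inv_le_of_inv_le₀ hm (le_max_left _ _)
    · exact Finset.prod_nonneg fun k _ => by positivity
  · have hP : 1 ≤ ∏ k ∈ Finset.range n, (1 + (L.ℓ + 1) / (L.ℓ - 1) * (L.a k : ℝ)) :=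
      Finset.one_le_prod fun k _ => by
        have : 0 ≤ (L.ℓ + 1) / (L.ℓ - 1) * (L.a k : ℝ) :=
          mul_nonneg (div_nonneg (by linarith) (by linarith)) (Nat.cast_nonneg _)
        linarith
    refine le_trans ?_ (mul_le_mul_of_nonneg_right (le_max_right _ _) (zero_le_one.trans hP))
    rw [add_mul]
    exact h2.trans (add_le_add (hup n) (le_mul_of_one_le_right hκ hP))
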